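/- arXiv:1208.5120 — 2 statements merged into one kernel-verified Lean document; each statement's English description precedes it below -/
import Mathlib

section
/- Let p ≤ q be projections in an AW*-algebra A with p properly infinite. Then there exist a projection p′ ∈ A and a central projection z ≤ c(p) such that: zp ∼ zq; (c(p) − z)p ∼ p′ ≤ (c(p) − z)(q − p); and c(p′) = c(p) − z. -/
universe u

section Defs

variable {R : Type u} [Ring R] [StarRing R]

/-- An element is a projection if it is self-adjoint and idempotent. -/
def IsProjection (p : R) : Prop := star p = p ∧ p * p = p

/-- Order on projections: `e ≤ f` iff `e = ef`. -/
def ProjLE (e f : R) : Prop := e * f = e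

/-- Murray–von Neumann equivalence of projections. -/
def ProjEquiv (e f : R) : Prop := ∃ v : R, star v * v = e ∧ v * star v = f

/-- `e ≼ f` : `e` is equivalent to a subprojection of `f`. -/
def ProjSubEquiv (e f : R) : Prop :=
  ∃ e' : R, IsProjection e' ∧ ProjLE e' f ∧ ProjEquiv e e'

/-- `e ≺ f` : `e ≼ f` but `e` is not equivalent to `f` (with the convention `0 ≺ 0`). -/
def ProjLT (e f : R) : Prop :=
  (ProjSubEquiv e f ∧ ¬ ProjEquiv e f) ∨ (e = 0 ∧ f = 0)

/-- A central projection. -/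
def IsCentralProj (z : R) : Prop := IsProjection z ∧ ∀ a : R, z * a = a * z

/-- `c` is the central cover of `e`: the least central projection above `e`. -/
def IsCentralCover (e c : R) : Prop :=
  IsCentralProj c ∧ ProjLE e c ∧
    ∀ z : R, IsCentralProj z → ProjLE e z → ProjLE c z

/-- A projection `e` is finite if `e ∼ f ≤ e` implies `f = e`. -/
def ProjFinite (e : R) : Prop :=
  ∀ f : R, IsProjection f → ProjEquiv e f → ProjLE f e → f = e

/-- A nonzero projection is properly infinite if `ze` is infinite
for every central projection `z` with `ze ≠ 0`. -/
def ProperlyInfinite (e : R) : Prop :=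
  IsProjection e ∧ e ≠ 0 ∧
    ∀ z : R, IsCentralProj z → z * e ≠ 0 → ¬ ProjFinite (z * e)

/-- A pairwise orthogonal family of elements. -/
def PairwiseOrthogonal {ι : Type*} (p : ι → R) : Prop :=
  ∀ i j, i ≠ j → p i * p j = 0

/-- `s` is the supremum of the family `p` in the projection order. For an
orthogonal family, this is the sum `Σ pᵢ`. -/
def IsSupProj {ι : Type*} (p : ι → R) (s : R) : Prop :=
  IsProjection s ∧ (∀ i, ProjLE (p i) s) ∧
    ∀ t : R, IsProjection t → (∀ i, ProjLE (p i) t) → ProjLE s t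

/-- The family `p` belongs to `Γ(e)`: an orthogonal family of projections,
each equivalent to `e`, with sum (supremum) `e`. -/
def InGamma (e : R) {ι : Type u} (p : ι → R) : Prop :=
  (∀ i, IsProjection (p i)) ∧ PairwiseOrthogonal p ∧
    (∀ i, ProjEquiv (p i) e) ∧ IsSupProj p e

open Classical in
/-- The dimension `d(e)` of a properly infinite projection: the least cardinal
strictly greater than the cardinality of the index set of every family in
`Γ(e)`, with the convention `d(0) = 0`. -/
noncomputable def projDim (e : R) : Cardinal.{u} :=
  if e = 0 then 0
  else sSup {c : Cardinal.{u} |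
    ∃ (ι : Type u) (p : ι → R), InGamma e p ∧ c = Order.succ (Cardinal.mk ι)}

/-- A properly infinite projection `e` is equidimensional if `d(ze) = d(e)`
for every central projection `z` with `ze ≠ 0` (equivalently, for every
nonzero central projection `z ≤ c(e)`). -/
def Equidimensional (e : R) : Prop :=
  ProperlyInfinite e ∧
    ∀ z : R, IsCentralProj z → z * e ≠ 0 → projDim (z * e) = projDim e

/-- An abelian projection: the corner `eRe` is commutative. -/
def IsAbelianProj (e : R) : Prop :=
  IsProjection e ∧ ∀ a b : R, (e * a * e) * (e * b * e) = (e * b * e) * (e * a * e)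

/-- `j` is the join `e ∨ f` in the projection lattice. -/
def IsJoinProj (e f j : R) : Prop :=
  IsProjection j ∧ ProjLE e j ∧ ProjLE f j ∧
    ∀ t : R, IsProjection t → ProjLE e t → ProjLE f t → ProjLE j t

end Defs

/-- The AW*-condition: the right annihilator of any subset is generated by a
projection: `{a | ∀ s ∈ S, s a = 0} = pR`. -/
def IsAWStarRing (R : Type*) [Ring R] [StarRing R] : Prop :=
  ∀ S : Set R, ∃ p : R, IsProjection p ∧
    {a : R | ∀ s ∈ S, s * a = 0} = {a : R | ∃ b : R, a = p * b}

/-- A maximal abelian (*-sub)algebra. -/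
def IsMaximalAbelian {A : Type*} [Ring A] [StarRing A] [Algebra ℂ A] [StarModule ℂ A]
    (M : StarSubalgebra ℂ A) : Prop :=
  (∀ x ∈ M, ∀ y ∈ M, x * y = y * x) ∧
    ∀ N : StarSubalgebra ℂ A, (∀ x ∈ N, ∀ y ∈ N, x * y = y * x) → M ≤ N → M = N


section Help

lemma ra {A : Type u} [Ring A] {a b c : A} (h : a * b = c) (y : A) : a * (b * y) = c * y := by
  rw [← mul_assoc, h]

/-- `s` is the projection sum (supremum) of the family `x`. -/
def IsSm {A : Type u} [Ring A] [StarRing A] {ι : Type u} (x : ι → A) (s : A) : Prop :=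
  IsProjection s ∧ (∀ i, s * x i = x i) ∧ ∀ y : A, (∀ i, y * x i = 0) → y * s = 0

section alg
variable {A : Type u} [Ring A] [StarRing A]

lemma pr_zero : IsProjection (0 : A) := by simp [IsProjection]

lemma orth_symm {e f : A} (he : IsProjection e) (hf : IsProjection f) (h : e * f = 0) :
    f * e = 0 := by
  have := congrArg star h
  simpa [he.1, hf.1] using this

lemma le_symm {e f : A} (he : IsProjection e) (hf : IsProjection f) (h : e * f = e) :
    f * e = e := by
  have := congrArg star h
  simpa [he.1, hf.1] using this

lemma le_symm' {e f : A} (he : IsProjection e) (hf : IsProjection f) (h : f * e = e) :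
    e * f = e := by
  have := congrArg star h
  simpa [he.1, hf.1] using this

lemma pr_add {e f : A} (he : IsProjection e) (hf : IsProjection f) (h : e * f = 0) :
    IsProjection (e + f) := by
  have h2 := orth_symm he hf h
  refine ⟨by simp [he.1, hf.1], by simp [mul_add, add_mul, he.2, hf.2, h, h2]⟩

lemma pr_sub {e f : A} (he : IsProjection e) (hf : IsProjection f) (h : e * f = e) :
    IsProjection (f - e) := by
  have h2 := le_symm he hf h
  refine ⟨by simp [he.1, hf.1], by simp [mul_sub, sub_mul, he.2, hf.2, h, h2]⟩

lemma pr_cmul {z e : A} (hz : IsCentralProj z) (he : IsProjection e) : IsProjection (z * e) := by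
  refine ⟨by rw [star_mul, he.1, hz.1.1, hz.2], ?_⟩
  rw [mul_assoc, ← mul_assoc e, ← hz.2 e, mul_assoc, he.2, ← mul_assoc, hz.1.2]

lemma cmul_orth {z e f : A} (hz : IsCentralProj z) (h : e * f = 0) : (z * e) * (z * f) = 0 := by
  rw [hz.2 e, mul_assoc, ← mul_assoc z z, hz.1.2, hz.2 f, ← mul_assoc, h, zero_mul]

lemma cmul_le {z e f : A} (hz : IsCentralProj z) (h : e * f = e) : (z * e) * (z * f) = z * e := by
  rw [hz.2 e, mul_assoc, ← mul_assoc z z, hz.1.2, hz.2 f, ← mul_assoc, h]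

lemma cen_compl {z : A} (hz : IsCentralProj z) : IsCentralProj (1 - z) := by
  refine ⟨⟨by simp [hz.1.1], by simp [mul_sub, sub_mul, hz.1.2]⟩, fun a => ?_⟩
  rw [sub_mul, mul_sub, hz.2]; simp

lemma cen_mul {z w : A} (hz : IsCentralProj z) (hw : IsCentralProj w) : IsCentralProj (z * w) := by
  refine ⟨pr_cmul hz hw.1, fun a => ?_⟩
  rw [mul_assoc, hw.2, ← mul_assoc, hz.2, mul_assoc]

lemma eq_symm' {e f : A} (h : ProjEquiv e f) : ProjEquiv f e := by
  obtain ⟨v, h1, h2⟩ := h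
  exact ⟨star v, by simpa using h2, by simpa using h1⟩

lemma eq_refl' {e : A} (h : IsProjection e) : ProjEquiv e e :=
  ⟨e, by rw [h.1, h.2], by rw [h.1, h.2]⟩

lemma eq_cut {z e f : A} (hz : IsCentralProj z) (h : ProjEquiv e f) :
    ProjEquiv (z * e) (z * f) := by
  obtain ⟨v, rfl, rfl⟩ := h
  refine ⟨z * v, ?_, ?_⟩
  · rw [star_mul, hz.1.1, mul_assoc, ← mul_assoc z, hz.1.2, ← mul_assoc, ← hz.2, mul_assoc]
  · rw [star_mul, hz.1.1, mul_assoc, ← mul_assoc v, ← hz.2, ← mul_assoc, hz.1.2]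

lemma sm_exists (hAW : IsAWStarRing A) {ι : Type u} (x : ι → A) : ∃ s, IsSm x s := by
  obtain ⟨p, hp, hS⟩ := hAW (Set.range fun i => star (x i))
  have h1 : ∀ i, star (x i) * p = 0 := by
    have : p ∈ {a : A | ∀ s ∈ Set.range fun i => star (x i), s * a = 0} := by
      rw [hS]; exact ⟨1, by simp⟩
    intro i
    exact this _ ⟨i, rfl⟩
  refine ⟨1 - p, ⟨by simp [hp.1], by simp [mul_sub, sub_mul, hp.2]⟩, fun i => ?_, fun y hy => ?_⟩
  · have := congrArg star (h1 i)
    simp [hp.1] at this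
    simp [sub_mul, this]
  · have : star y ∈ {a : A | ∃ b : A, a = p * b} := by
      rw [← hS]
      rintro _ ⟨i, rfl⟩
      have := congrArg star (hy i)
      simpa using this
    obtain ⟨b, hb⟩ := this
    have h2 : p * star y = star y := by rw [hb, ← mul_assoc, hp.2]
    have h3 := congrArg star h2
    simp [hp.1] at h3
    simp [mul_sub, h3]

lemma sm_unique {ι : Type u} {x : ι → A} {s t : A} (hs : IsSm x s) (ht : IsSm x t) : s = t := by
  have key : ∀ s t : A, IsSm x s → IsSm x t → t * s = s := by
    intro s t hs ht
    have := hs.2.2 (1 - t) (fun i => by simp [sub_mul, ht.2.1])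
    rw [sub_mul, one_mul, sub_eq_zero] at this
    exact this.symm
  have h1 := key s t hs ht
  have h2 := le_symm' ht.1 hs.1 (key t s ht hs)
  rw [← h1, h2]

lemma sm_le {ι : Type u} {x : ι → A} {s t : A} (hs : IsSm x s) (ht : IsProjection t)
    (h : ∀ i, t * x i = x i) : s * t = s := by
  have := hs.2.2 (1 - t) (fun i => by simp [sub_mul, h])
  rw [sub_mul, one_mul, sub_eq_zero] at this
  exact le_symm' hs.1 ht this.symm

lemma sm_orth {ι κ : Type u} {x : ι → A} {y : κ → A} {s t : A} (hs : IsSm x s) (ht : IsSm y t)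
    (hy : ∀ j, IsProjection (y j)) (h : ∀ i j, y j * x i = 0) : s * t = 0 := by
  refine ht.2.2 s fun j => ?_
  exact orth_symm (hy j) hs.1 (hs.2.2 (y j) fun i => h i j)

lemma sm_reindex {ι κ : Type u} {x : ι → A} {s : A} (hs : IsSm x s) (φ : κ ≃ ι) :
    IsSm (fun k => x (φ k)) s := by
  refine ⟨hs.1, fun k => hs.2.1 _, fun y hy => hs.2.2 y fun i => ?_⟩
  simpa using hy (φ.symm i)

lemma sm_sum {ι κ : Type u} {x : ι → A} {y : κ → A} {s t : A} (hs : IsSm x s) (ht : IsSm y t)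
    (h : s * t = 0) : IsSm (Sum.elim x y) (s + t) := by
  have h' := orth_symm hs.1 ht.1 h
  refine ⟨pr_add hs.1 ht.1 h, ?_, fun w hw => ?_⟩
  · rintro (i | j)
    · have : t * x i = 0 := by rw [← hs.2.1 i, ← mul_assoc, h', zero_mul]
      simp [add_mul, this, hs.2.1]
    · have : s * y j = 0 := by rw [← ht.2.1 j, ← mul_assoc, h, zero_mul]
      simp [add_mul, this, ht.2.1]
  · rw [mul_add, hs.2.2 w fun i => hw (Sum.inl i), ht.2.2 w fun i => hw (Sum.inr i), add_zero]

lemma sm_add {ι : Type u} {x y : ι → A} {s t : A} (hs : IsSm x s) (ht : IsSm y t)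
    (hx : ∀ i, IsProjection (x i)) (hy : ∀ i, IsProjection (y i)) (hxy : ∀ i, x i * y i = 0)
    (h : s * t = 0) : IsSm (fun i => x i + y i) (s + t) := by
  have h' := orth_symm hs.1 ht.1 h
  refine ⟨pr_add hs.1 ht.1 h, fun i => ?_, fun w hw => ?_⟩
  · have h1 : t * x i = 0 := by rw [← hs.2.1 i, ← mul_assoc, h', zero_mul]
    have h2 : s * y i = 0 := by rw [← ht.2.1 i, ← mul_assoc, h, zero_mul]
    simp [add_mul, mul_add, h1, h2, hs.2.1, ht.2.1]
  · have hyx : ∀ i, y i * x i = 0 := fun i => orth_symm (hx i) (hy i) (hxy i)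
    rw [mul_add, hs.2.2 w fun i => ?_, ht.2.2 w fun i => ?_, add_zero]
    · have := congrArg (· * y i) (hw i)
      simpa [mul_assoc, add_mul, (hy i).2, hxy] using this
    · have := congrArg (· * x i) (hw i)
      simpa [mul_assoc, add_mul, (hx i).2, hyx] using this

lemma sm_cut {ι : Type u} {x : ι → A} {s z : A} (hs : IsSm x s) (hz : IsCentralProj z) :
    IsSm (fun i => z * x i) (z * s) := by
  refine ⟨pr_cmul hz hs.1, fun i => ?_, fun w hw => ?_⟩
  · rw [hz.2 s, mul_assoc, ← mul_assoc z z, hz.1.2, hz.2 (x i), ← mul_assoc, hs.2.1]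
    exact (hz.2 (x i)).symm
  · rw [← mul_assoc]
    exact hs.2.2 _ fun i => by rw [mul_assoc]; exact hw i

lemma sm_single {e : A} (he : IsProjection e) : IsSm (fun _ : PUnit.{u+1} => e) e :=
  ⟨he, fun _ => he.2, fun _ h => h PUnit.unit⟩

lemma sm_cen {ι : Type u} {x : ι → A} {s : A} (hs : IsSm x s) (hx : ∀ i a, x i * a = a * x i) :
    IsCentralProj s := by
  have key : ∀ a, a * s = s * a * s := by
    intro a
    have := hs.2.2 ((1 - s) * a) fun i => by
      rw [mul_assoc, ← hx, ← mul_assoc, sub_mul, hs.2.1]; simp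
    rw [sub_mul, sub_mul, one_mul, sub_eq_zero] at this
    exact this
  refine ⟨hs.1, fun a => ?_⟩
  have h := congrArg star (key (star a))
  simp only [star_mul, star_star, hs.1.1] at h
  exact h.trans (by rw [← mul_assoc]; exact (key a).symm)

/-- Zorn for pairwise related families. -/
lemma zorn_pw {X : Type u} (P : X → Prop) (R : X → X → Prop) (T0 : Set X)
    (h0 : ∀ v ∈ T0, P v) (h0' : T0.Pairwise R) :
    ∃ T : Set X, T0 ⊆ T ∧ (∀ v ∈ T, P v) ∧ T.Pairwise R ∧
      ∀ v, P v → (∀ w ∈ T, R v w ∧ R w v) → v ∈ T := by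
  obtain ⟨T, hT0, hT⟩ := zorn_subset_nonempty {T : Set X | (∀ v ∈ T, P v) ∧ T.Pairwise R} (by
    intro c hc hch hne
    refine ⟨⋃₀ c, ⟨?_, ?_⟩, fun s hs => Set.subset_sUnion_of_mem hs⟩
    · rintro v ⟨t, ht, hv⟩
      exact (hc ht).1 v hv
    · exact (Set.pairwise_sUnion hch.directedOn).2 fun t ht => (hc ht).2) T0 ⟨h0, h0'⟩
  refine ⟨T, hT0, hT.prop.1, hT.prop.2, fun v hv hR => ?_⟩
  have h : insert v T ∈ {T : Set X | (∀ v ∈ T, P v) ∧ T.Pairwise R} := by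
    refine ⟨?_, ?_⟩
    · rintro w (rfl | hw)
      · exact hv
      · exact hT.prop.1 w hw
    · exact hT.prop.2.insert fun w hw _ => hR w hw
  exact hT.le_of_ge h (Set.subset_insert v T) (Set.mem_insert v T)

end alg

section cs
variable {A : Type u} [NormedRing A] [StarRing A] [CStarRing A]

lemma pi_right {v e : A} (he : IsProjection e) (h : star v * v = e) : v * e = v := by
  have : star (v * e - v) * (v * e - v) = 0 := by
    simp only [star_sub, star_mul, he.1, sub_mul, mul_sub, mul_assoc, ra h, h, he.2]
    simp
  exact sub_eq_zero.1 ((CStarRing.star_mul_self_eq_zero_iff _).1 this)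

lemma pi_proj {v e : A} (he : IsProjection e) (h : star v * v = e) : IsProjection (v * star v) := by
  refine ⟨by simp, ?_⟩
  rw [mul_assoc, ra h, ← mul_assoc, pi_right he h]

lemma pi_left {v e f : A} (he : IsProjection e) (h : star v * v = e) (h2 : v * star v = f) :
    f * v = v := by
  rw [← h2, mul_assoc, h, pi_right he h]

lemma eq_proj {e f : A} (he : IsProjection e) (h : ProjEquiv e f) : IsProjection f := by
  obtain ⟨v, h1, rfl⟩ := h
  exact pi_proj he h1

lemma eq_zero' {e : A} (h : ProjEquiv e 0) : e = 0 := by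
  obtain ⟨v, h1, h2⟩ := h
  rw [CStarRing.mul_star_self_eq_zero_iff] at h2
  rw [← h1, h2, mul_zero]

lemma eq_trans' {e f g : A} (he : IsProjection e) (h : ProjEquiv e f) (h' : ProjEquiv f g) :
    ProjEquiv e g := by
  have hf := eq_proj he h
  obtain ⟨v, h1, h2⟩ := h
  obtain ⟨w, h3, h4⟩ := h'
  refine ⟨w * v, ?_, ?_⟩
  · rw [star_mul, mul_assoc, ra h3, pi_left he h1 h2, h1]
  · rw [star_mul, mul_assoc, ra h2, ← mul_assoc, pi_right hf h3, h4]

lemma eq_add {e f e' f' : A} (he : IsProjection e) (he' : IsProjection e') (h : ProjEquiv e f)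
    (h' : ProjEquiv e' f') (ho : e * e' = 0) (ho' : f * f' = 0) :
    ProjEquiv (e + e') (f + f') := by
  have hf := eq_proj he h
  have hf' := eq_proj he' h'
  obtain ⟨v, h1, h2⟩ := h
  obtain ⟨w, h3, h4⟩ := h'
  have a1 : star v * w = 0 := by
    have := congrArg star (pi_left he h1 h2)
    rw [star_mul, hf.1] at this
    rw [← this, ← pi_left he' h3 h4, mul_assoc, ra ho', zero_mul, mul_zero]
  have a2 : v * star w = 0 := by
    have := congrArg star (pi_right he' h3)
    rw [star_mul, he'.1] at this
    rw [← this, ← pi_right he h1, mul_assoc, ra ho, zero_mul, mul_zero]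
  have a3 : star w * v = 0 := by simpa using congrArg star a1
  have a4 : w * star v = 0 := by simpa using congrArg star a2
  refine ⟨v + w, ?_, ?_⟩
  · simp [add_mul, mul_add, h1, h3, a1, a3]
  · simp [add_mul, mul_add, h2, h4, a2, a4]

lemma eq_sub {e f g : A} (he : IsProjection e) (h : ProjEquiv e f) (hg : IsProjection g)
    (hge : g * e = g) : ∃ h, IsProjection h ∧ h * f = h ∧ ProjEquiv g h := by
  have hf := eq_proj he h
  obtain ⟨v, h1, h2⟩ := h
  have hv : star (v * g) * (v * g) = g := by
    rw [star_mul, mul_assoc, ra h1, hg.1, ← mul_assoc, hge, hg.2]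
  refine ⟨v * g * star (v * g), pi_proj hg hv, ?_, v * g, hv, rfl⟩
  refine le_symm' (pi_proj hg hv) hf ?_
  rw [← mul_assoc, ← mul_assoc, pi_left he h1 h2]

lemma sb (hAW : IsAWStarRing A) {e f e' : A} (he : IsProjection e) (hf : IsProjection f)
    (hfe : f * e = f) (he' : e' * f = e') (h : ProjEquiv e e') : ProjEquiv e f := by
  have hp' := eq_proj he h
  obtain ⟨v, h1, h2⟩ := h
  have hv1 := pi_right he h1
  have hv2 := pi_left he h1 h2
  have hef := le_symm hf he hfe
  have hfv : f * v = v := by rw [← hv2, ← mul_assoc, le_symm hp' hf he']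
  have hev : e * v = v := by rw [← hfv, ← mul_assoc, hef]
  have hsv : star v * e = star v := by simpa [he.1] using congrArg star hev
  have hsvf : star v * f = star v := by simpa [hf.1] using congrArg star hfv
  let x : ℕ → A := fun n => Nat.rec (e - f) (fun _ y => v * y * star v) n
  have x0 : x 0 = e - f := rfl
  have xs : ∀ n, x (n+1) = v * x n * star v := fun n => rfl
  have xe : ∀ n, x n * e = x n := by
    intro n
    cases n with
    | zero => rw [x0, sub_mul, he.2, hfe]
    | succ n => rw [xs, mul_assoc, hsv]
  have xe' : ∀ n, e * x n = x n := by
    intro n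
    cases n with
    | zero => rw [x0, mul_sub, he.2, hef]
    | succ n => rw [xs, ← mul_assoc, ← mul_assoc, hev]
  obtain ⟨s, hs⟩ := sm_exists hAW (fun n : ULift.{u} ℕ => x n.down)
  have hse : s * e = s := sm_le hs he fun i => xe' _
  have hes := le_symm hs.1 he hse
  have hd : (e - f) * v = 0 := by rw [sub_mul, hev, hfv, sub_self]
  have hd' : star v * (e - f) = 0 := by rw [mul_sub, hsv, hsvf, sub_self]
  have hs' : IsSm (fun n : ULift.{u} ℕ => x n.down) ((e - f) + v * s * star v) := by
    have hpr : IsProjection (v * s * star v) := by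
      refine ⟨by simp [hs.1.1, mul_assoc], ?_⟩
      simp only [mul_assoc, ra h1, ra hes, ra hs.1.2]
    refine ⟨pr_add (pr_sub hf he hfe) hpr (by rw [← mul_assoc, ← mul_assoc, hd]; simp), ?_, ?_⟩
    · rintro ⟨n⟩
      cases n with
      | zero =>
        simp only [x0, add_mul, mul_assoc, hd', (pr_sub hf he hfe).2]; simp
      | succ n =>
        have := hs.2.1 ⟨n⟩
        simp only at this
        simp only [xs, add_mul, mul_assoc, ra h1, ra hd, ra hes, ra (xe' n), ra this]; simp
    · intro y hy
      have h3 : y * v * s = 0 := by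
        refine hs.2.2 _ fun n => ?_
        have := congrArg (· * v) (hy ⟨n.down + 1⟩)
        simpa [xs, mul_assoc, h1, xe] using this
      have h4 := hy ⟨0⟩
      simp only [x0] at h4
      rw [mul_add, h4, ← mul_assoc, ← mul_assoc, h3]; simp
  have heq := sm_unique hs hs'
  have hes' : f = v * s * star v + (e - s) := by
    have : s - (v * s * star v) = e - f := by rw [sub_eq_iff_eq_add]; exact heq
    have : f = e - (s - (v * s * star v)) := by rw [this]; abel
    rw [this]; abel
  have heq2 : e = s + (e - s) := by abel
  have hsub := pr_sub hs.1 he hse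
  have hvs : ProjEquiv s (v * s * star v) := by
    refine ⟨v * s, ?_, ?_⟩
    · rw [star_mul, mul_assoc, ra h1, hs.1.1, ra hse, hs.1.2]
    · rw [star_mul, hs.1.1, mul_assoc, ra hs.1.2, mul_assoc]
  have ho : s * (e - s) = 0 := by rw [mul_sub, hse, hs.1.2, sub_self]
  have ho' : v * s * star v * (e - s) = 0 := by
    have : v * s * star v = s - (e - f) := by rw [eq_sub_iff_add_eq, add_comm]; exact heq.symm
    have hs0 := hs.2.1 ⟨0⟩
    simp only [x0] at hs0
    have hs1 := le_symm' (pr_sub hf he hfe) hs.1 hs0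
    rw [this, sub_mul, ho, mul_sub, hs1, sub_mul, he.2, hfe, sub_self, sub_self]
  rw [hes']
  have := eq_add hs.1 hsub hvs (eq_refl' hsub) ho ho'
  rwa [← heq2] at this

end cs

lemma ep_cfc {A : Type u} [CStarAlgebra A] (x : A) (hx : x ≠ 0) :
    ∃ H K : A, H * (star x * x) ≠ 0 ∧ star K = K ∧ star (H * (star x * x)) = H * (star x * x) ∧
      (K * (star x * x) * K - 1) * (H * (star x * x)) = 0 := by
  set a := star x * x with ha
  have hsa : IsSelfAdjoint a := IsSelfAdjoint.star_mul_self x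
  have hnn : ∀ t ∈ spectrum ℝ a, 0 ≤ t := spectrum_star_mul_self_nonneg
  have hc : 0 < ‖a‖ := by
    rw [norm_pos_iff]
    intro h
    exact hx ((CStarRing.star_mul_self_eq_zero_iff x).1 h)
  set c := ‖a‖ / 2 with hcdef
  have hc2 : 0 < c := by positivity
  let f1 : ℝ → ℝ := fun t => max (t - c) 0
  let k : ℝ → ℝ := fun t => (Real.sqrt (max t c))⁻¹
  have hf1 : Continuous f1 := by fun_prop
  have hk : Continuous k := by
    apply Continuous.inv₀ (by fun_prop)
    intro t
    have : 0 < max t c := lt_max_of_lt_right hc2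
    positivity
  have hid : cfc (fun t : ℝ => t) a = a := cfc_id' ℝ a
  have hF : cfc f1 a * a = cfc (fun t => f1 t * t) a := by
    conv_lhs => rw [← hid]
    rw [hid]
    nth_rewrite 2 [← hid]
    rw [← cfc_mul f1 (fun t => t) a hf1.continuousOn (by fun_prop)]
  have hK : cfc k a * a * cfc k a = cfc (fun t => k t * t * k t) a := by
    nth_rewrite 2 [← hid]
    rw [← cfc_mul k (fun t => t) a hk.continuousOn (by fun_prop),
      ← cfc_mul _ k a (by fun_prop) hk.continuousOn]
  refine ⟨cfc f1 a, cfc k a, ?_, ?_, ?_, ?_⟩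
  · rw [hF]
    intro h0
    have h1 : ∀ t ∈ spectrum ℝ a, f1 t * t = 0 := by
      have := (cfc_eq_cfc_iff_eqOn (R := ℝ) (a := a) (f := fun t => f1 t * t) (g := fun _ => 0)
        hsa (by fun_prop) (by fun_prop)).1 (by rw [h0]; simp)
      exact this
    have h2 : ‖cfc (fun t : ℝ => t) a‖ ≤ c := by
      apply norm_cfc_le hc2.le
      intro t ht
      rw [Real.norm_eq_abs, abs_of_nonneg (hnn t ht)]
      by_contra hlt
      push Not at hlt
      have := h1 t ht
      have h3 : 0 < f1 t := lt_max_of_lt_left (by linarith)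
      have : 0 < f1 t * t := mul_pos h3 (by linarith)
      linarith
    rw [hid] at h2
    linarith
  · exact cfc_predicate k a
  · rw [hF]; exact (cfc_predicate (fun t : ℝ => f1 t * t) a : IsSelfAdjoint _)
  · rw [hF, hK, ← cfc_one ℝ a, ← cfc_sub _ _ a (by fun_prop) (by fun_prop), ← cfc_mul _ _ a (by fun_prop) (by fun_prop)]
    rw [← cfc_zero ℝ a]
    apply cfc_congr
    intro t ht
    simp only [Pi.one_apply, Pi.zero_apply]
    by_cases htc : t ≤ c
    · have : f1 t = 0 := max_eq_right (by linarith)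
      simp [this]
    · push Not at htc
      have : k t * t * k t = 1 := by
        simp only [k, max_eq_left htc.le]
        have h0 : 0 < t := by linarith
        have := Real.mul_self_sqrt h0.le
        have h5 : 0 < Real.sqrt t := Real.sqrt_pos.2 h0
        field_simp
        nlinarith
      rw [this]; simp

section big
variable {A : Type u} [NormedRing A] [StarRing A] [CStarRing A]
    [NormedAlgebra ℂ A] [StarModule ℂ A] [CompleteSpace A]

lemma ep (hAW : IsAWStarRing A) (x : A) (hx : x ≠ 0) :
    ∃ v b : A, v = x * b ∧ v ≠ 0 ∧ IsProjection (star v * v) ∧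
      ∀ g, IsProjection g → x * g = x → v * g = v := by
  let _ : CStarAlgebra A := {}
  obtain ⟨H, K, h1, hK, hF, h2⟩ := ep_cfc x hx
  obtain ⟨r, hr⟩ := sm_exists hAW (fun _ : PUnit.{u+1} => H * (star x * x))
  have hr1 := hr.2.1 PUnit.unit
  simp only at hr1
  have hr2 := hr.2.2 _ (fun _ => h2)
  rw [sub_mul, one_mul, sub_eq_zero] at hr2
  have hv : star (x * (K * r)) * (x * (K * r)) = r := by
    rw [star_mul, star_mul, hK, hr.1.1]
    calc r * K * star x * (x * (K * r)) = r * (K * (star x * x) * K * r) := by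
          simp only [mul_assoc]
      _ = r := by rw [hr2, hr.1.2]
  refine ⟨x * (K * r), K * r, rfl, ?_, ?_, ?_⟩
  · intro h0
    rw [h0, mul_zero] at hv
    rw [← hv, zero_mul] at hr1
    exact h1 hr1.symm
  · rw [hv]; exact hr.1
  · intro g hg hxg
    have h3 : H * (star x * x) * g = H * (star x * x) := by
      rw [mul_assoc, mul_assoc, hxg]
    have h4 : g * (H * (star x * x)) = H * (star x * x) := by
      have := congrArg star h3
      rwa [star_mul, hF, hg.1] at this
    have h5 := sm_le hr hg (fun _ => h4)
    rw [mul_assoc, mul_assoc, h5]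

/-- Orthogonal additivity of equivalence. -/
lemma orthosum (hAW : IsAWStarRing A) {ι : Type u} {x y : ι → A} {e f : A} (he : IsSm x e)
    (hf : IsSm y f) (hx : ∀ i, IsProjection (x i)) (hy : ∀ i, IsProjection (y i))
    (hxx : ∀ i j, i ≠ j → x i * x j = 0) (hyy : ∀ i j, i ≠ j → y i * y j = 0)
    (hxy : ∀ i j, x i * y j = 0) (h : ∀ i, ProjEquiv (x i) (y i)) : ProjEquiv e f := by
  choose v h1 h2 using h
  have hyx : ∀ i j, y j * x i = 0 := fun i j => orth_symm (hx i) (hy j) (hxy i j)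
  have v1 : ∀ i, v i * x i = v i := fun i => pi_right (hx i) (h1 i)
  have v2 : ∀ i, y i * v i = v i := fun i => pi_left (hx i) (h1 i) (h2 i)
  have v3 : ∀ i, x i * star (v i) = star (v i) := fun i => by
    simpa [(hx i).1] using congrArg star (v1 i)
  have v4 : ∀ i, star (v i) * y i = star (v i) := fun i => by
    simpa [(hy i).1] using congrArg star (v2 i)
  have xv : ∀ i j, x i * v j = 0 := fun i j => by rw [← v2 j, ra (hxy i j), zero_mul]
  have vy : ∀ i j, v i * y j = 0 := fun i j => by rw [← v1 i, mul_assoc, hxy i j, mul_zero]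
  have yv : ∀ i j, y i * star (v j) = 0 := fun i j => by
    rw [← v3 j, ra (hyx j i), zero_mul]
  have vx : ∀ i j, star (v i) * x j = 0 := fun i j => by
    rw [← v4 i, mul_assoc, hyx, mul_zero]
  have vv : ∀ i j, v i * v j = 0 := fun i j => by rw [← v1 i, mul_assoc, xv, mul_zero]
  have vv' : ∀ i j, star (v i) * star (v j) = 0 := fun i j => by
    rw [← v4 i, mul_assoc, yv, mul_zero]
  have vx0 : ∀ i j, i ≠ j → v i * x j = 0 := fun i j hij => by
    rw [← v1 i, mul_assoc, hxx i j hij, mul_zero]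
  have yv0 : ∀ i j, i ≠ j → y i * v j = 0 := fun i j hij => by
    rw [← v2 j, ra (hyy i j hij), zero_mul]
  have vy0 : ∀ i j, i ≠ j → star (v i) * y j = 0 := fun i j hij => by
    rw [← v4 i, mul_assoc, hyy i j hij, mul_zero]
  have xv0 : ∀ i j, i ≠ j → x i * star (v j) = 0 := fun i j hij => by
    rw [← v3 j, ra (hxx i j hij), zero_mul]
  -- doubled projections
  let g : ι → A := fun i => (2⁻¹ : ℂ) • (x i + y i + v i + star (v i))
  have hgs : ∀ i, star (g i) = g i := fun i => by
    simp only [g, star_smul, star_add, (hx i).1, (hy i).1, star_star]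
    have : star (2⁻¹ : ℂ) = 2⁻¹ := by simp
    rw [this]; congr 1; abel
  obtain ⟨G, hG⟩ := sm_exists hAW g
  have hgx : ∀ i, g i * x i = (2⁻¹ : ℂ) • (x i + v i) := fun i => by
    simp [g, add_mul, (hx i).2, hyx, v1, vx]
  have hgy : ∀ i, g i * y i = (2⁻¹ : ℂ) • (y i + star (v i)) := fun i => by
    simp [g, add_mul, (hy i).2, hxy, v4, vy]
  have hgx0 : ∀ j i, j ≠ i → g j * x i = 0 := fun j i hij => by
    simp [g, add_mul, hxx j i hij, hyx, vx0 j i hij, vx]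
  have hgy0 : ∀ j i, j ≠ i → g j * y i = 0 := fun j i hij => by
    simp [g, add_mul, hyy j i hij, hxy, vy0 j i hij, vy]
  have hgv : ∀ i, g i * v i = (2⁻¹ : ℂ) • (x i + v i) := fun i => by
    simp [g, add_mul, xv, v2, vv, h1, add_comm]
  have hgv' : ∀ i, g i * star (v i) = (2⁻¹ : ℂ) • (y i + star (v i)) := fun i => by
    simp [g, add_mul, yv, v3, vv', h2, add_comm]
  have hgg : ∀ i, g i * g i = g i := fun i => by
    have : g i * g i = (2⁻¹ : ℂ) • (g i * x i + g i * y i + g i * v i + g i * star (v i)) := by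
      conv_lhs => rhs; unfold g
      rw [mul_smul_comm, mul_add, mul_add, mul_add]
    rw [this, hgx, hgy, hgv, hgv']
    simp only [g]
    module
  have hgg0 : ∀ j i, j ≠ i → g j * g i = 0 := fun j i hij => by
    have : g j * g i = (2⁻¹ : ℂ) • (g j * x i + g j * y i + g j * v i + g j * star (v i)) := by
      conv_lhs => rhs; unfold g
      rw [mul_smul_comm, mul_add, mul_add, mul_add]
    rw [this, hgx0 j i hij, hgy0 j i hij, ← v2 i, ← mul_assoc, hgy0 j i hij, v2 i, ← v3 i,
      ← mul_assoc, hgx0 j i hij]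
    simp
  have hGh : ∀ i, G * (x i + y i) = g i := fun i => by
    have hsa : star ((x i + y i) - g i) = (x i + y i) - g i := by
      simp [hgs, (hx i).1, (hy i).1]
    have hgh : ∀ j, g j * ((x i + y i) - g i) = 0 := fun j => by
      by_cases hij : j = i
      · subst hij
        rw [mul_sub, mul_add, hgg, hgx, hgy]
        simp only [g]
        module
      · rw [mul_sub, mul_add, hgg0 j i hij, hgx0 j i hij, hgy0 j i hij]; simp
    have h3 := hG.2.2 ((x i + y i) - g i) fun j => by
      have := congrArg star (hgh j)
      rwa [star_mul, hsa, hgs, star_zero] at this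
    have h4 := congrArg star h3
    rw [star_mul, hsa, hG.1.1, star_zero, mul_sub, hG.2.1, sub_eq_zero] at h4
    exact h4
  have hGx : ∀ i, G * x i = (2⁻¹ : ℂ) • (x i + v i) := fun i => by
    have : x i = (x i + y i) * x i := by rw [add_mul, (hx i).2, hyx, add_zero]
    rw [this, ← mul_assoc, hGh, hgx, ← this]
  have hGy : ∀ i, G * y i = (2⁻¹ : ℂ) • (y i + star (v i)) := fun i => by
    have : y i = (x i + y i) * y i := by rw [add_mul, (hy i).2, hxy, zero_add]
    rw [this, ← mul_assoc, hGh, hgy, ← this]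
  have hef : e * f = 0 := sm_orth he hf hy fun i j => hyx i j
  have hfe := orth_symm he.1 hf.1 hef
  have hfx : ∀ i, f * x i = 0 := fun i => by rw [← he.2.1 i, ra hfe, zero_mul]
  have hey : ∀ i, e * y i = 0 := fun i => by rw [← hf.2.1 i, ra hef, zero_mul]
  have hfv : ∀ i, f * v i = v i := fun i => by rw [← v2 i, ra (hf.2.1 i)]
  have hev : ∀ i, e * star (v i) = star (v i) := fun i => by rw [← v3 i, ra (he.2.1 i)]
  let w : A := (2 : ℂ) • (f * G * e)
  have hws : star w = (2 : ℂ) • (e * G * f) := by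
    simp [w, star_smul, he.1.1, hf.1.1, hG.1.1, mul_assoc]
  have hwx : ∀ i, w * x i = v i := fun i => by
    simp only [w, smul_mul_assoc, mul_assoc, he.2.1, hGx, mul_smul_comm, mul_add, hfx, hfv]
    simp [smul_smul]
  have hwy : ∀ i, star w * y i = star (v i) := fun i => by
    rw [hws]
    simp only [smul_mul_assoc, mul_assoc, hf.2.1, hGy, mul_smul_comm, mul_add, hey, hev]
    simp [smul_smul]
  have hwe : w * e = w := by simp only [w, smul_mul_assoc, mul_assoc, he.1.2]
  have hwf : star w * f = star w := by rw [hws]; simp only [smul_mul_assoc, mul_assoc, hf.1.2]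
  refine ⟨w, ?_, ?_⟩
  · have := he.2.2 (star w * w - 1) fun i => by
      rw [sub_mul, mul_assoc, hwx, ← v2 i, ← mul_assoc, hwy, h1, one_mul, sub_self]
    rwa [sub_mul, mul_assoc, hwe, one_mul, sub_eq_zero] at this
  · have := hf.2.2 (w * star w - 1) fun i => by
      rw [sub_mul, mul_assoc, hwy, ← v3 i, ← mul_assoc, hwx, h2, one_mul, sub_self]
    rwa [sub_mul, mul_assoc, hwf, one_mul, sub_eq_zero] at this

lemma compar (hAW : IsAWStarRing A) {e f : A} (he : IsProjection e) (hf : IsProjection f)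
    (hef : e * f = 0) : ∃ z : A, IsCentralProj z ∧
      (∃ h, IsProjection h ∧ h * (z * e) = h ∧ ProjEquiv (z * f) h) ∧
      (∃ h, IsProjection h ∧ h * ((1 - z) * f) = h ∧ ProjEquiv ((1 - z) * e) h) := by
  obtain ⟨T, -, hT, hTR, hTm⟩ := zorn_pw
    (fun v : A => v ≠ 0 ∧ IsProjection (star v * v) ∧ v * e = v ∧ f * v = v)
    (fun v w => v * star w = 0 ∧ star v * w = 0) ∅ (by simp) (by simp)
  have hfe := orth_symm he hf hef
  obtain ⟨e', he'⟩ := sm_exists hAW (fun v : T => star v.1 * v.1)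
  obtain ⟨f', hf'⟩ := sm_exists hAW (fun v : T => v.1 * star v.1)
  have hee : e' * e = e' := sm_le he' he fun v => by
    have := congrArg star (hT v.1 v.2).2.2.1
    rw [star_mul, he.1] at this
    rw [ra this]
  have hff : f' * f = f' := sm_le hf' hf fun v => by rw [ra (hT v.1 v.2).2.2.2]
  have hequiv : ProjEquiv e' f' := by
    refine orthosum hAW he' hf' (fun v => (hT v.1 v.2).2.1)
      (fun v => pi_proj (hT v.1 v.2).2.1 rfl) ?_ ?_ ?_ (fun v => ⟨v.1, rfl, rfl⟩)
    · intro v w hvw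
      rw [mul_assoc, ra (hTR v.2 w.2 fun h => hvw (Subtype.ext h)).1]; simp
    · intro v w hvw
      rw [mul_assoc, ra (hTR v.2 w.2 fun h => hvw (Subtype.ext h)).2]; simp
    · intro v w
      rw [mul_assoc, ← (hT v.1 v.2).2.2.1, ← (hT w.1 w.2).2.2.2]
      simp only [mul_assoc, ra hef]; simp
  have hpe := pr_sub he'.1 he hee
  have hpf := pr_sub hf'.1 hf hff
  have hzero : ∀ a, (f - f') * a * (e - e') = 0 := by
    intro a
    by_contra hne
    obtain ⟨v, b, hvb, hv0, hvp, hvg⟩ := ep hAW _ hne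
    have g1 : v * (e - e') = v := hvg _ hpe (by rw [mul_assoc, hpe.2])
    have g2 : (f - f') * v = v := by
      rw [hvb]; simp only [mul_assoc, ra hpf.2]
    have ke : ∀ w ∈ T, w * (e - e') = 0 := by
      intro w hw
      have h1 := le_symm' (hT w hw).2.1 he'.1 (he'.2.1 ⟨w, hw⟩)
      have h2 : w * (star w * w) = w := pi_right (hT w hw).2.1 rfl
      have h3 : w * e' = w := by
        have h4 : w * (star w * w) * e' = w * (star w * w) := by rw [mul_assoc, h1]
        rwa [h2] at h4
      rw [mul_sub, (hT w hw).2.2.1, h3, sub_self]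
    have kf : ∀ w ∈ T, (f - f') * w = 0 := by
      intro w hw
      have h1 := hf'.2.1 ⟨w, hw⟩
      simp only at h1
      have h2 : w * (star w * w) = w := pi_right (hT w hw).2.1 rfl
      have h3 : f' * w = w := by
        have h4 : f' * (w * (star w * w)) = w * (star w * w) := by
          rw [← mul_assoc w, ← mul_assoc, h1]
        rwa [h2] at h4
      rw [sub_mul, (hT w hw).2.2.2, h3, sub_self]
    have hvT : v ∈ T := by
      refine hTm v ⟨hv0, hvp, ?_, ?_⟩ ?_
      · conv_lhs => rw [← g1]
        rw [mul_assoc, sub_mul, he.2, hee, g1]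
      · conv_lhs => rw [← g2]
        rw [← mul_assoc, mul_sub, hf.2, le_symm hf'.1 hf hff, g2]
      · intro w hw
        have a1 : v * star w = 0 := by
          have := congrArg star (ke w hw)
          rw [star_mul, hpe.1, star_zero] at this
          rw [← g1, mul_assoc, this, mul_zero]
        have a2 : star v * w = 0 := by
          have := congrArg star g2
          rw [star_mul, hpf.1] at this
          rw [← this, mul_assoc, kf w hw, mul_zero]
        exact ⟨⟨a1, a2⟩, by simpa using congrArg star a1, by simpa using congrArg star a2⟩
    exact hv0 (by rw [← g1, ke v hvT])
  obtain ⟨z, hz⟩ := sm_exists hAW (fun a : A => a * (e - e'))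
  have hzc : IsCentralProj z := by
    have key : ∀ a, z * a * z = a * z := by
      intro a
      have := hz.2.2 ((1 - z) * a) fun b => by
        have := hz.2.1 (a * b)
        simp only [mul_assoc] at this
        simp only [mul_assoc, sub_mul, one_mul, this, sub_self]
      rw [mul_assoc, sub_mul, one_mul, sub_eq_zero] at this
      rw [mul_assoc, ← this]
    refine ⟨hz.1, fun a => ?_⟩
    have h := congrArg star (key (star a))
    simp only [star_mul, star_star, hz.1.1] at h
    rw [← h, ← mul_assoc, key]
  have z1 : z * (e - e') = e - e' := by simpa using hz.2.1 1
  have z2 : z * (f - f') = 0 := by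
    rw [hzc.2]
    exact hz.2.2 _ fun a => by rw [← mul_assoc]; exact hzero a
  refine ⟨z, hzc, ⟨z * e', pr_cmul hzc he'.1, cmul_le hzc hee, ?_⟩,
    ⟨(1 - z) * f', pr_cmul (cen_compl hzc) hf'.1, cmul_le (cen_compl hzc) hff, ?_⟩⟩
  · have : z * f = z * f' := by rwa [mul_sub, sub_eq_zero] at z2
    rw [this]
    exact eq_symm' (eq_cut hzc hequiv)
  · have : (1 - z) * e = (1 - z) * e' := by
      rw [← sub_eq_zero, ← mul_sub, sub_mul, one_mul, z1, sub_self]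
    rw [this]
    exact eq_cut (cen_compl hzc) hequiv

/-- `e` splits as three orthogonal equivalent pieces, each equivalent to sum of two. -/
def Trip (e : A) : Prop := ∃ a b c : A, IsProjection a ∧ IsProjection b ∧ IsProjection c ∧
  a * b = 0 ∧ a * c = 0 ∧ b * c = 0 ∧ a + b + c = e ∧
  ProjEquiv a b ∧ ProjEquiv a c ∧ ProjEquiv a (b + c)

lemma trip_cut {z e : A} (hz : IsCentralProj z) (h : Trip e) : Trip (z * e) := by
  obtain ⟨a, b, c, ha, hb, hc, hab, hac, hbc, hs, h1, h2, h3⟩ := h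
  refine ⟨z * a, z * b, z * c, pr_cmul hz ha, pr_cmul hz hb, pr_cmul hz hc, cmul_orth hz hab,
    cmul_orth hz hac, cmul_orth hz hbc, by rw [← hs]; noncomm_ring, eq_cut hz h1, eq_cut hz h2, ?_⟩
  rw [← mul_add]
  exact eq_cut hz h3

lemma absorb (hAW : IsAWStarRing A) {e f h : A} (ht : Trip e) (he : IsProjection e)
    (hf : IsProjection f) (hef : e * f = 0) (hh : IsProjection h) (hhe : h * e = h)
    (hfh : ProjEquiv f h) : ProjEquiv (e + f) e := by
  obtain ⟨a, b, c, ha, hb, hc, hab, hac, hbc, hs, h1, h2, h3⟩ := ht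
  have habc : a * (b + c) = 0 := by rw [mul_add, hab, hac, add_zero]
  have hbc' := pr_add hb hc hbc
  have e1 : ProjEquiv e (b + c) := by
    rw [← hs, add_assoc]
    exact eq_add ha hbc' h1 (eq_trans' hbc' (eq_symm' h3) h2) habc hbc
  have ea : ProjEquiv e a := eq_trans' he e1 (eq_symm' h3)
  have eb : ProjEquiv e b := eq_trans' he ea h1
  obtain ⟨k, hk, hkb, hhk⟩ := eq_sub he eb hh hhe
  have hak : a * k = 0 := by rw [← le_symm hk hb hkb, ← mul_assoc, hab, zero_mul]
  have hefk : ProjEquiv (e + f) (a + k) := eq_add he hf ea (eq_trans' hf hfh hhk) hef hak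
  have hae : a * e = a := by rw [← hs, mul_add, mul_add, ha.2, hab, hac]; simp
  have hbe : b * e = b := by rw [← hs, mul_add, mul_add, hb.2, orth_symm ha hb hab, hbc]; simp
  have hke : k * e = k := by rw [← hkb, mul_assoc, hbe]
  exact sb hAW (pr_add he hf hef) he (by rw [mul_add, he.2, hef, add_zero])
    (by rw [add_mul, hae, hke]) hefk

lemma local_trip (hAW : IsAWStarRing A) {p : A} (hp : IsProjection p) (hinf : ¬ ProjFinite p) :
    ∃ z, IsCentralProj z ∧ z * p ≠ 0 ∧ Trip (z * p) := by
  unfold ProjFinite at hinf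
  push Not at hinf
  obtain ⟨f, hf, ⟨v, h1, h2⟩, hfp, hne⟩ := hinf
  unfold ProjLE at hfp
  have hpf := le_symm hf hp hfp
  have hfv := pi_left hp h1 h2
  have hvp := pi_right hp h1
  have hpv : p * v = v := by rw [← hfv, ← mul_assoc, hpf]
  have hsv : star v * p = star v := by simpa [hp.1] using congrArg star hpv
  have hsvf : star v * f = star v := by simpa [hf.1] using congrArg star hfv
  let x : ℕ → A := fun n => Nat.rec (p - f) (fun _ y => v * y * star v) n
  have x0 : x 0 = p - f := rfl
  have xs : ∀ n, x (n+1) = v * x n * star v := fun n => rfl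
  have hx0 : IsProjection (x 0) := pr_sub hf hp hfp
  have hd : (p - f) * v = 0 := by rw [sub_mul, hpv, hfv, sub_self]
  have hd' : star v * (p - f) = 0 := by rw [mul_sub, hsv, hsvf, sub_self]
  have xe : ∀ n, x n * p = x n := by
    intro n
    cases n with
    | zero => rw [x0, sub_mul, hp.2, hfp]
    | succ n => rw [xs, mul_assoc, hsv]
  have xeq : ∀ n, ProjEquiv (x 0) (x n) := by
    intro n
    induction n with
    | zero => exact eq_refl' hx0
    | succ n ih =>
      have hxn := eq_proj hx0 ih
      refine eq_trans' hx0 ih ⟨v * x n, ?_, ?_⟩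
      · rw [star_mul, mul_assoc, ra h1, hxn.1, ← mul_assoc, xe, hxn.2]
      · rw [star_mul, hxn.1, mul_assoc, ra hxn.2, xs, mul_assoc]
  have hxp : ∀ n, IsProjection (x n) := fun n => eq_proj hx0 (xeq n)
  have hx0n : x 0 ≠ 0 := fun h => hne (sub_eq_zero.1 (x0 ▸ h)).symm
  have hxn0 : ∀ n, x n ≠ 0 := fun n h => hx0n (eq_zero' (h ▸ xeq n))
  have xorth : ∀ n m, n < m → x n * x m = 0 := by
    intro n
    induction n with
    | zero =>
      intro m hm
      obtain ⟨k, rfl⟩ := Nat.exists_eq_succ_of_ne_zero (by omega : m ≠ 0)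
      rw [Nat.succ_eq_add_one, xs, x0, ← mul_assoc, ← mul_assoc, hd]; simp
    | succ n ih =>
      intro m hm
      obtain ⟨k, rfl⟩ := Nat.exists_eq_succ_of_ne_zero (by omega : m ≠ 0)
      have hk := ih k (by omega)
      have hpx : p * x k = x k := le_symm (hxp k) hp (xe k)
      rw [Nat.succ_eq_add_one, xs, xs]
      simp only [mul_assoc, ra h1, ra hpx, ra hk]; simp
  have xorth' : ∀ n m, n ≠ m → x n * x m = 0 := by
    intro n m h
    rcases lt_or_gt_of_ne h with h | h
    · exact xorth n m h
    · exact orth_symm (hxp m) (hxp n) (xorth m n h)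
  have xinj : Function.Injective x := by
    intro n m h
    by_contra hnm
    have := xorth' n m hnm
    rw [← h, (hxp n).2] at this
    exact hxn0 n this
  obtain ⟨S, hS0, hS, hSR, hSm⟩ := zorn_pw
    (fun g : A => g * p = g ∧ ProjEquiv (x 0) g) (fun g h => g * h = 0) (Set.range x)
    (by rintro _ ⟨n, rfl⟩; exact ⟨xe n, xeq n⟩)
    (by
      rintro _ ⟨n, rfl⟩ _ ⟨m, rfl⟩ h
      exact xorth' n m fun hh => h (congrArg x hh))
  have hSinf : Infinite S := ((Set.infinite_range_of_injective xinj).mono hS0).to_subtype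
  have hSp : ∀ g : S, IsProjection g.1 := fun g => eq_proj hx0 (hS g.1 g.2).2
  obtain ⟨s, hs⟩ := sm_exists hAW (fun g : S => g.1)
  have hsp : s * p = s := sm_le hs hp fun g => le_symm (hSp g) hp (hS g.1 g.2).1
  have hr := pr_sub hs.1 hp hsp
  have hrg : ∀ g ∈ S, (p - s) * g = 0 := fun g hg => by
    rw [sub_mul, le_symm (hSp ⟨g, hg⟩) hp (hS g hg).1, hs.2.1 ⟨g, hg⟩, sub_self]
  have hrx := hrg (x 0) (hS0 ⟨0, rfl⟩)
  obtain ⟨z, hz, ⟨r', hr', hrle, hrr⟩, ⟨k, hk, hkle, hxk⟩⟩ :=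
    compar hAW hx0 hr (orth_symm hr hx0 hrx)
  have hze : z * x 0 ≠ 0 := by
    intro h0
    have h3 : (1 - z) * x 0 = x 0 := by rw [sub_mul, h0]; simp
    rw [h3] at hxk
    have hkr : k * (p - s) = k := by
      rw [← hkle, mul_assoc, mul_assoc, hr.2]
    have hkp : k * p = k := by
      rw [← hkr, mul_assoc, sub_mul, hp.2, hsp]
    have hkS : k ∈ S := by
      refine hSm k ⟨hkp, hxk⟩ fun w hw => ?_
      have : k * w = 0 := by rw [← hkr, mul_assoc, hrg w hw, mul_zero]
      exact ⟨this, orth_symm hk (hSp ⟨w, hw⟩) this⟩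
    have := hrg k hkS
    rw [le_symm hk hr hkr] at this
    rw [this] at hxk
    exact hx0n (eq_zero' hxk)
  refine ⟨z, hz, ?_, ?_⟩
  · intro h0
    apply hze
    rw [← le_symm hx0 hp (xe 0), ← mul_assoc, h0, zero_mul]
  -- the index bijections
  obtain ⟨φ⟩ : Nonempty ((S ⊕ (S ⊕ S)) ≃ S) := by
    rw [← Cardinal.eq]; simp
  obtain ⟨ψ⟩ : Nonempty ((S ⊕ S) ≃ S) := by
    rw [← Cardinal.eq]; simp
  obtain ⟨θ⟩ : Nonempty ((PUnit.{u+1} ⊕ S) ≃ S) := by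
    rw [← Cardinal.eq]
    simpa using Cardinal.add_eq_right (Cardinal.aleph0_le_mk S)
      (le_trans Cardinal.one_le_aleph0 (Cardinal.aleph0_le_mk S))
  let g : (S ⊕ (S ⊕ S)) → A := fun i => z * (φ i).1
  have hg : ∀ i, IsProjection (g i) := fun i => pr_cmul hz (hSp _)
  have hgo : ∀ i j, i ≠ j → g i * g j = 0 := fun i j hij =>
    cmul_orth hz (hSR (φ i).2 (φ j).2 fun h => hij (φ.injective (Subtype.ext h)))
  have hgx : ∀ i, ProjEquiv (z * x 0) (g i) := fun i => eq_cut hz (hS _ (φ i).2).2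
  have hzx := pr_cmul hz hx0
  have hgg : ∀ i j, ProjEquiv (g i) (g j) := fun i j =>
    eq_trans' (hg i) (eq_symm' (hgx i)) (hgx j)
  have hgsum : IsSm g (z * s) := sm_reindex (sm_cut hs hz) φ
  obtain ⟨G0, hG0⟩ := sm_exists hAW (fun i => g (Sum.inl i))
  obtain ⟨G1, hG1⟩ := sm_exists hAW (fun i => g (Sum.inr (Sum.inl i)))
  obtain ⟨G2, hG2⟩ := sm_exists hAW (fun i => g (Sum.inr (Sum.inr i)))
  have o01 : G0 * G1 = 0 := sm_orth hG0 hG1 (fun _ => hg _) fun i j => hgo _ _ (by simp)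
  have o02 : G0 * G2 = 0 := sm_orth hG0 hG2 (fun _ => hg _) fun i j => hgo _ _ (by simp)
  have o12 : G1 * G2 = 0 := sm_orth hG1 hG2 (fun _ => hg _) fun i j => hgo _ _ (by simp)
  have o0 : G0 * (G1 + G2) = 0 := by rw [mul_add, o01, o02, add_zero]
  have hG12 := sm_sum hG1 hG2 o12
  have htot : G0 + (G1 + G2) = z * s := by
    refine sm_unique (sm_sum hG0 hG12 o0) ?_
    convert hgsum using 1
    funext i
    rcases i with i | i | i <;> rfl
  have q01 : ProjEquiv G0 G1 := orthosum hAW hG0 hG1 (fun _ => hg _) (fun _ => hg _)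
    (fun i j h => hgo _ _ (by simpa using h)) (fun i j h => hgo _ _ (by simpa using h))
    (fun i j => hgo _ _ (by simp)) (fun i => hgg _ _)
  have q02 : ProjEquiv G0 G2 := orthosum hAW hG0 hG2 (fun _ => hg _) (fun _ => hg _)
    (fun i j h => hgo _ _ (by simpa using h)) (fun i j h => hgo _ _ (by simpa using h))
    (fun i j => hgo _ _ (by simp)) (fun i => hgg _ _)
  have hG12' : IsSm (fun i => g (Sum.inr i)) (G1 + G2) := by
    convert hG12 using 1
    funext i
    rcases i with i | i <;> rfl
  have q0 : ProjEquiv G0 (G1 + G2) := orthosum hAW (sm_reindex hG0 ψ) hG12' (fun _ => hg _)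
    (fun _ => hg _)
    (fun i j h => hgo _ _ (by simpa using h)) (fun i j h => hgo _ _ (by simpa using h))
    (fun i j => hgo _ _ (by simp)) (fun i => hgg _ _)
  -- absorb the remainder
  have hzr := pr_cmul hz hr
  have hzrs : (z * (p - s)) * (z * s) = 0 := cmul_orth hz (by rw [sub_mul, le_symm hs.1 hp hsp, hs.1.2, sub_self])
  have hG0s : z * s * G0 = G0 := by
    rw [← htot, add_mul, hG0.1.2, orth_symm hG0.1 hG12.1 o0, add_zero]
  have hG1s : z * s * G1 = G1 := by
    rw [← htot, add_mul, add_mul, hG1.1.2, o01, orth_symm hG1.1 hG2.1 o12]; simp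
  have hG2s : z * s * G2 = G2 := by
    rw [← htot, add_mul, add_mul, hG2.1.2, o02, o12]; simp
  have r0 : (z * (p - s)) * G0 = 0 := by rw [← hG0s, ← mul_assoc, hzrs, zero_mul]
  have r1 : (z * (p - s)) * G1 = 0 := by rw [← hG1s, ← mul_assoc, hzrs, zero_mul]
  have r2 : (z * (p - s)) * G2 = 0 := by rw [← hG2s, ← mul_assoc, hzrs, zero_mul]
  have r2' := orth_symm hzr hG2.1 r2
  have hc := pr_add hG2.1 hzr r2'
  have qc : ProjEquiv (G2 + z * (p - s)) G2 := by
    let d := g (Sum.inl (θ (Sum.inl PUnit.unit)))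
    obtain ⟨B, hB⟩ := sm_exists hAW (fun i => g (Sum.inl (θ (Sum.inr i))))
    have hd : IsProjection d := hg _
    have hdB : d * B = 0 := sm_orth (sm_single hd) hB (fun _ => hg _)
      fun i j => hgo _ _ (by simp)
    have hdBsum : d + B = G0 := by
      refine sm_unique (sm_sum (sm_single hd) hB hdB) ?_
      convert sm_reindex hG0 θ using 1
      funext i
      rcases i with i | i <;> rfl
    have qB : ProjEquiv G2 B := orthosum hAW hG2 hB (fun _ => hg _) (fun _ => hg _)
      (fun i j h => hgo _ _ (by simpa using h)) (fun i j h => hgo _ _ (by simpa using h))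
      (fun i j => hgo _ _ (by simp)) (fun i => hgg _ _)
    obtain ⟨r'', hr'', hrd, hrr2⟩ := eq_sub hzx (hgx (Sum.inl (θ (Sum.inl PUnit.unit)))) hr' hrle
    have hrd' : r'' * d = r'' := hrd
    have hBd := orth_symm hd hB.1 hdB
    have hBr : B * r'' = 0 := by rw [← le_symm hr'' hd hrd', ← mul_assoc, hBd, zero_mul]
    have qE : ProjEquiv (G2 + z * (p - s)) (B + r'') :=
      eq_add hG2.1 hzr qB (eq_trans' hzr hrr hrr2) r2' hBr
    have hle : (B + r'') * G0 = B + r'' := by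
      have hrB : r'' * B = 0 := orth_symm hB.1 hr'' hBr
      rw [← hdBsum, add_mul, mul_add, mul_add, hBd, hB.1.2, hrd', hrB]; simp
    obtain ⟨m, hm, hmG, hmq⟩ := eq_sub hG0.1 q02 (pr_add hB.1 hr'' hBr) hle
    exact sb hAW hc hG2.1 (by rw [mul_add, hG2.1.2, r2', add_zero]) hmG (eq_trans' hc qE hmq)
  have oc1 : G1 * (G2 + z * (p - s)) = 0 := by
    rw [mul_add, o12, orth_symm hzr hG1.1 r1, add_zero]
  have oc0 : G0 * (G2 + z * (p - s)) = 0 := by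
    rw [mul_add, o02, orth_symm hzr hG0.1 r0, add_zero]
  refine ⟨G0, G1, G2 + z * (p - s), hG0.1, hG1.1, hc, o01, oc0, oc1, ?_, q01, ?_, ?_⟩
  · have : z * p = z * s + z * (p - s) := by noncomm_ring
    rw [this, ← htot]; abel
  · exact eq_trans' hG0.1 q02 (eq_symm' qc)
  · exact eq_trans' hG0.1 q0 (eq_add hG1.1 hG2.1 (eq_refl' hG1.1) (eq_symm' qc) o12 oc1)

lemma sm_cut_mem {ι : Type u} {w x : ι → A} {a : A} (ha : IsSm x a)
    (hw : ∀ i, IsCentralProj (w i)) (hww : ∀ i j, i ≠ j → w i * w j = 0)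
    (hx : ∀ i, IsProjection (x i)) (hwx : ∀ i, w i * x i = x i) (i : ι) : a * w i = x i := by
  have h1 : ∀ j, (w i - x i) * x j = 0 := by
    intro j
    by_cases hij : i = j
    · subst hij
      rw [sub_mul, hwx, (hx i).2, sub_self]
    · have h2 : w i * x j = 0 := by rw [← hwx j, ra (hww i j hij), zero_mul]
      have h3 : x i * x j = 0 := by
        rw [← le_symm' (hx i) (hw i).1 (hwx i), mul_assoc, h2, mul_zero]
      rw [sub_mul, h2, h3, sub_self]
  have h2 := congrArg star (ha.2.2 _ h1)
  rw [star_mul, star_sub, (hw i).1.1, (hx i).1, ha.1.1, star_zero, mul_sub, ha.2.1,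
    sub_eq_zero] at h2
  exact h2

lemma global_trip (hAW : IsAWStarRing A) {p : A} (hp : ProperlyInfinite p) : Trip p := by
  obtain ⟨hpp, -, hinf⟩ := hp
  obtain ⟨T, -, hT, hTR, hTm⟩ := zorn_pw
    (fun z : A => IsCentralProj z ∧ z ≠ 0 ∧ Trip (z * p)) (fun z w => z * w = 0) ∅
    (by simp) (by simp)
  obtain ⟨Z, hZ⟩ := sm_exists hAW (fun z : T => z.1)
  have hZc : IsCentralProj Z := sm_cen hZ fun z => (hT z.1 z.2).1.2
  have hZp : Z * p = p := by
    by_contra hne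
    have h1 : (1 - Z) * p ≠ 0 := by
      rw [sub_mul, one_mul, sub_ne_zero]; exact fun h => hne h.symm
    have hc := cen_compl hZc
    obtain ⟨z, hz, hz0, hzt⟩ := local_trip hAW (pr_cmul hc hpp) (hinf _ hc h1)
    rw [← mul_assoc] at hz0 hzt
    have hw : z * (1 - Z) ∈ T := by
      refine hTm _ ⟨cen_mul hz hc, fun h => hz0 (by rw [h, zero_mul]), hzt⟩ fun w hw => ?_
      have h2 : z * (1 - Z) * w = 0 := by
        rw [mul_assoc, sub_mul, hZ.2.1 ⟨w, hw⟩]; simp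
      exact ⟨h2, by rw [(hT w hw).1.2]; exact h2⟩
    have h3 : Z * (z * (1 - Z)) = z * (1 - Z) := hZ.2.1 ⟨_, hw⟩
    have h4 : z * (1 - Z) = 0 := by
      rw [← h3, hZc.2, mul_assoc, sub_mul, hZc.1.2]; simp
    exact hz0 (by rw [h4, zero_mul])
  have hall : ∀ z : T, Trip (z.1 * p) := fun z => (hT z.1 z.2).2.2
  choose a b c ha hb hc hab hac hbc hsum q1 q2 q3 using hall
  have hw : ∀ i : T, IsCentralProj i.1 := fun i => (hT i.1 i.2).1
  have hww : ∀ i j : T, i ≠ j → i.1 * j.1 = 0 := fun i j h =>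
    hTR i.2 j.2 fun hh => h (Subtype.ext hh)
  have hsz : ∀ i, i.1 * (a i + b i + c i) = a i + b i + c i := fun i => by
    rw [hsum, ← mul_assoc, (hw i).1.2]
  have hwa : ∀ i, i.1 * a i = a i := fun i => by
    have : a i = (a i + b i + c i) * a i := by
      rw [add_mul, add_mul, (ha i).2, orth_symm (ha i) (hb i) (hab i),
        orth_symm (ha i) (hc i) (hac i)]; simp
    rw [this, ← mul_assoc, hsz]
  have hwb : ∀ i, i.1 * b i = b i := fun i => by
    have : b i = (a i + b i + c i) * b i := by
      rw [add_mul, add_mul, (hb i).2, hab i,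
        orth_symm (hb i) (hc i) (hbc i)]; simp
    rw [this, ← mul_assoc, hsz]
  have hwc : ∀ i, i.1 * c i = c i := fun i => by
    have : c i = (a i + b i + c i) * c i := by
      rw [add_mul, add_mul, (hc i).2, hac i, hbc i]; simp
    rw [this, ← mul_assoc, hsz]
  have cross : ∀ (x y : T → A), (∀ i, IsProjection (x i)) → (∀ i, i.1 * x i = x i) →
      (∀ i, i.1 * y i = y i) → ∀ i j, i ≠ j → x i * y j = 0 := by
    intro x y hx hwx hwy i j hij
    rw [← le_symm' (hx i) (hw i).1 (hwx i), ← hwy j, mul_assoc, ra (hww i j hij), zero_mul,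
      mul_zero]
  have crossA : ∀ (x y : T → A), (∀ i, IsProjection (x i)) → (∀ i, i.1 * x i = x i) →
      (∀ i, i.1 * y i = y i) → (∀ i, x i * y i = 0) → ∀ i j, x i * y j = 0 := by
    intro x y hx hwx hwy hxy i j
    by_cases hij : i = j
    · subst hij; exact hxy i
    · exact cross x y hx hwx hwy i j hij
  obtain ⟨sa, hsa⟩ := sm_exists hAW a
  obtain ⟨sb, hsb⟩ := sm_exists hAW b
  obtain ⟨sc, hsc⟩ := sm_exists hAW c
  have oab : sa * sb = 0 := sm_orth hsa hsb hb fun i j =>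
    crossA b a hb hwb hwa (fun i => orth_symm (ha i) (hb i) (hab i)) j i
  have oac : sa * sc = 0 := sm_orth hsa hsc hc fun i j =>
    crossA c a hc hwc hwa (fun i => orth_symm (ha i) (hc i) (hac i)) j i
  have obc : sb * sc = 0 := sm_orth hsb hsc hc fun i j =>
    crossA c b hc hwc hwb (fun i => orth_symm (hb i) (hc i) (hbc i)) j i
  have hsbc := sm_add hsb hsc hb hc hbc obc
  have hbcp : ∀ i, IsProjection (b i + c i) := fun i => pr_add (hb i) (hc i) (hbc i)
  have hwbc : ∀ i, i.1 * (b i + c i) = b i + c i := fun i => by rw [mul_add, hwb, hwc]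
  refine ⟨sa, sb, sc, hsa.1, hsb.1, hsc.1, oab, oac, obc, ?_, ?_, ?_, ?_⟩
  · have h0 := hZ.2.2 (sa + sb + sc - p) fun i => by
      rw [sub_mul, add_mul, add_mul, sm_cut_mem hsa hw hww ha hwa i,
        sm_cut_mem hsb hw hww hb hwb i, sm_cut_mem hsc hw hww hc hwc i, hsum, (hw i).2, sub_self]
    have za : ∀ (x : T → A) (s : A), IsSm x s → (∀ i, i.1 * x i = x i) → s * Z = s := by
      intro x s hs hx
      refine sm_le hs hZ.1 fun i => ?_
      rw [← hx i, ra (hZ.2.1 i)]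
    rw [sub_mul, add_mul, add_mul, za a sa hsa hwa, za b sb hsb hwb, za c sc hsc hwc,
      ← hZc.2, hZp, sub_eq_zero] at h0
    exact h0
  · exact orthosum hAW hsa hsb ha hb (cross a a ha hwa hwa) (cross b b hb hwb hwb)
      (crossA a b ha hwa hwb hab) q1
  · exact orthosum hAW hsa hsc ha hc (cross a a ha hwa hwa) (cross c c hc hwc hwc)
      (crossA a c ha hwa hwc hac) q2
  · exact orthosum hAW hsa hsbc ha hbcp (cross a a ha hwa hwa)
      (cross _ _ hbcp hwbc hwbc)
      (crossA _ _ ha hwa hwbc (fun i => by rw [mul_add, hab, hac, add_zero])) q3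

end big

end Help

/-- Let `p ≤ q` be projections with `p` properly infinite. Then there are a
projection `p'` and a central projection `z ≤ c(p)` with `zp ∼ zq`,
`(c(p) - z)p ∼ p' ≤ (c(p) - z)(q - p)` and `c(p') = c(p) - z`. -/
theorem eunderf {A : Type u} [NormedRing A] [StarRing A] [CStarRing A]
    [NormedAlgebra ℂ A] [StarModule ℂ A] [CompleteSpace A]
    (hAW : IsAWStarRing A) (p q cp : A)
    (hp : ProperlyInfinite p) (hq : IsProjection q) (hpq : ProjLE p q)
    (hcp : IsCentralCover p cp) :
    ∃ p' z : A, IsProjection p' ∧ IsCentralProj z ∧ ProjLE z cp ∧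
      ProjEquiv (z * p) (z * q) ∧
      ProjEquiv ((cp - z) * p) p' ∧ ProjLE p' ((cp - z) * (q - p)) ∧
      IsCentralCover p' (cp - z) := by
  have hpp := hp.1
  unfold ProjLE at hpq
  have hqp := le_symm hpp hq hpq
  have hd := pr_sub hpp hq hpq
  have hpd : p * (q - p) = 0 := by rw [mul_sub, hpq, hpp.2, sub_self]
  obtain ⟨hcc, hpc, hmin⟩ := hcp
  unfold ProjLE at hpc
  have hcpp := le_symm hpp hcc.1 hpc
  obtain ⟨z, hz, ⟨h, hh, hhle, hhq⟩, ⟨p', hp', hple, hpeq⟩⟩ := compar hAW hpp hd hpd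
  have htrip := global_trip hAW hp
  have hz0 := cen_mul hz hcc
  have hz1 := cen_compl hz
  have hzc0 : z * cp * cp = z * cp := by rw [mul_assoc, hcc.1.2]
  have hsubc : cp - z * cp = (1 - z) * cp := by rw [sub_mul, one_mul]
  have hcut : (cp - z * cp) * p = (1 - z) * p := by rw [hsubc, mul_assoc, hcpp]
  -- p' and (1 - z) p are below the same central projections
  have hcen : ∀ w, IsCentralProj w → (p' * w = p' ↔ (1 - z) * p * w = (1 - z) * p) := by
    intro w hw
    have hzp := pr_cmul hz1 hpp
    obtain ⟨v, h1, h2⟩ := hpeq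
    have hv1 := pi_right hzp h1
    have hv2 := pi_left hzp h1 h2
    constructor
    · intro h3
      have : v * w = v := by
        rw [← hv2, mul_assoc, ← hw.2 v, ← mul_assoc, h3]
      rw [← h1, mul_assoc, this]
    · intro h3
      have : v * w = v := by
        rw [← hv1, mul_assoc, h3]
      rw [← h2, mul_assoc, ← hw.2, ← mul_assoc, this]
  have hp'c : p' * cp = p' := (hcen cp hcc).2 (by rw [mul_assoc, hpc])
  refine ⟨p', z * cp, hp', hz0, hzc0, ?_, ?_, ?_, ?_, ?_, ?_⟩
  · -- absorption
    have e1 : ProjEquiv (z * cp * (q - p)) (cp * h) := by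
      have := eq_cut hcc hhq
      rwa [← mul_assoc, hcc.2] at this
    have hle : cp * h * (z * cp * p) = cp * h := by
      have := cmul_le hcc hhle
      rwa [← mul_assoc cp z p, hcc.2 z] at this
    have := absorb hAW (trip_cut hz0 htrip) (pr_cmul hz0 hpp) (pr_cmul hz0 hd)
      (cmul_orth hz0 hpd) (pr_cmul hcc hh) hle e1
    rw [← mul_add, add_sub_cancel] at this
    exact eq_symm' this
  · rw [hcut]; exact hpeq
  · show p' * ((cp - z * cp) * (q - p)) = p'
    rw [hsubc, hz1.2 cp, mul_assoc, ra hp'c, hple]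
  · rw [hsubc]; exact cen_mul hz1 hcc
  · show p' * (cp - z * cp) = p'
    have h3 : p' * (1 - z) = p' := (hcen _ hz1).2 (by
      rw [mul_assoc, ← hz1.2 p, ← mul_assoc, hz1.1.2])
    rw [hsubc, ra h3, hp'c]
  · intro w hw hpw
    have h3 := (hcen w hw).1 hpw
    show (cp - z * cp) * w = cp - z * cp
    have hw1 := cen_compl hw
    have ht := cen_compl (cen_mul hz1 hw1)
    have h4 : p * ((1 - z) * (1 - w)) = 0 := by
      rw [← mul_assoc, ← hz1.2 p, mul_sub, h3, mul_one, sub_self]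
    have h5 := hmin _ ht (by show p * _ = p; rw [mul_sub, h4, mul_one, sub_zero])
    have h6 : cp * ((1 - z) * (1 - w)) = 0 := by
      have : cp * (1 - (1 - z) * (1 - w)) = cp := h5
      rw [mul_sub, mul_one, sub_eq_self] at this
      exact this
    rw [← mul_assoc, ← hz1.2 cp, ← hsubc, mul_sub, mul_one, sub_eq_zero] at h6
    exact h6.symm
end

section
/- Let e and f be properly infinite projections in an AW*-algebra A. If c(e) = c(f) and e ≼ f, then d(e) ≤ d(f). -/
universe u

namespace AWProof

structure Good (A : Type*) [Ring A] [StarRing A] : Prop where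
  aw : IsAWStarRing A
  half : ∃ h : A, h + h = 1 ∧ star h = h ∧ ∀ a, h * a = a * h
  proper : ∀ x : A, star x * x = 0 → x = 0
  eq : ∀ x : A, x ≠ 0 → ∃ y t : A, IsProjection (star (x * y) * (x * y)) ∧
    star (x * y) * (x * y) ≠ 0 ∧ star (x * y) * (x * y) = star x * t

section
variable {A : Type*} [Ring A] [StarRing A]

lemma eqv_refl {e : A} (he : IsProjection e) : ProjEquiv e e :=
  ⟨e, by rw [he.1, he.2], by rw [he.1, he.2]⟩

lemma eqv_symm {e f : A} (h : ProjEquiv e f) : ProjEquiv f e := by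
  obtain ⟨v, h1, h2⟩ := h
  exact ⟨star v, by simpa using h2, by simpa using h1⟩

lemma eqv_trans {e f g : A} (he : IsProjection e) (hg : IsProjection g)
    (h : ProjEquiv e f) (h' : ProjEquiv f g) : ProjEquiv e g := by
  obtain ⟨v, h1, h2⟩ := h
  obtain ⟨w, h3, h4⟩ := h'
  refine ⟨w * v, ?_, ?_⟩
  · calc star (w * v) * (w * v) = star v * (star w * w) * v := by simp [mul_assoc]
      _ = (star v * v) * (star v * v) := by rw [h3, ← h2]; simp [mul_assoc]
      _ = e := by rw [h1, he.2]
  · calc (w * v) * star (w * v) = w * (v * star v) * star w := by simp [mul_assoc]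
      _ = (w * star w) * (w * star w) := by rw [h2, ← h3]; simp [mul_assoc]
      _ = g := by rw [h4, hg.2]

lemma le_comm {e f : A} (he : IsProjection e) (hf : IsProjection f) (h : e * f = e) :
    f * e = e := by
  have := congrArg star h
  simpa [he.1, hf.1] using this

lemma orth_comm {e f : A} (he : IsProjection e) (hf : IsProjection f) (h : e * f = 0) :
    f * e = 0 := by
  have := congrArg star h
  simpa [he.1, hf.1] using this

lemma sub_proj {e f : A} (he : IsProjection e) (hf : IsProjection f) (h : e * f = e) :
    IsProjection (f - e) := by
  have h' := le_comm he hf h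
  refine ⟨by simp [he.1, hf.1], ?_⟩
  rw [sub_mul, mul_sub, mul_sub, hf.2, he.2, h, h']; simp

lemma add_proj {e f : A} (he : IsProjection e) (hf : IsProjection f) (h : e * f = 0) :
    IsProjection (e + f) := by
  have h' := orth_comm he hf h
  refine ⟨by simp [he.1, hf.1], ?_⟩
  rw [add_mul, mul_add, mul_add, hf.2, he.2, h, h']; simp

lemma one_proj : IsProjection (1 : A) := ⟨by simp, by simp⟩

lemma cmul_proj {z e : A} (hz : IsCentralProj z) (he : IsProjection e) :
    IsProjection (z * e) := by
  refine ⟨by rw [star_mul, he.1, hz.1.1, hz.2], ?_⟩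
  calc z * e * (z * e) = z * (e * z) * e := by simp [mul_assoc]
    _ = (z * z) * (e * e) := by rw [← hz.2]; simp [mul_assoc]
    _ = _ := by rw [hz.1.2, he.2]

lemma compl_central {z : A} (hz : IsCentralProj z) : IsCentralProj (1 - z) :=
  ⟨sub_proj hz.1 one_proj (by simp), fun a => by rw [sub_mul, mul_sub, hz.2]; simp⟩

lemma mul_central {z y : A} (hz : IsCentralProj z) (hy : IsCentralProj y) :
    IsCentralProj (z * y) :=
  ⟨cmul_proj hz hy.1, fun a => by rw [mul_assoc, hy.2, ← mul_assoc, hz.2, mul_assoc]⟩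

lemma cmul_eqv {z e f : A} (hz : IsCentralProj z) (h : ProjEquiv e f) :
    ProjEquiv (z * e) (z * f) := by
  obtain ⟨v, h1, h2⟩ := h
  refine ⟨z * v, ?_, ?_⟩
  · calc star (z * v) * (z * v) = star v * (z * z) * v := by simp [mul_assoc, hz.1.1]
      _ = z * e := by rw [hz.1.2, ← hz.2, mul_assoc, h1]
  · calc z * v * star (z * v) = z * (v * star v * z) := by simp [mul_assoc, hz.1.1]
      _ = z * f := by rw [h2, ← hz.2, ← mul_assoc, hz.1.2]

variable (G : Good A)
include G

lemma pi_right {v e : A} (he : IsProjection e) (h : star v * v = e) : v * e = v := by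
  have : v - v * e = 0 := by
    apply G.proper
    have : star (v - v * e) * (v - v * e) =
      star v * v - (star v * v) * e - (e * (star v * v) - e * (star v * v) * e) := by
      simp only [star_sub, star_mul, he.1]; noncomm_ring
    rw [this, h]; simp [he.2]
  exact (sub_eq_zero.1 this).symm

lemma pi_left {v e f : A} (he : IsProjection e) (h : star v * v = e) (h' : v * star v = f) :
    f * v = v := by
  rw [← h', mul_assoc, h, pi_right G he h]

lemma pi_proj {v e f : A} (he : IsProjection e) (h : star v * v = e) (h' : v * star v = f) :
    IsProjection f := by
  refine ⟨by rw [← h']; simp, ?_⟩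
  conv_lhs => rw [← h']
  rw [mul_assoc, ← h', ← mul_assoc (star v), h, ← mul_assoc, pi_right G he h]

lemma eqv_ne {e f : A} (h : ProjEquiv e f) (he : e ≠ 0) : f ≠ 0 := by
  obtain ⟨v, h1, h2⟩ := h
  rintro rfl
  have : star v = 0 := G.proper _ (by simpa using h2)
  apply he; rw [← h1, this]; simp

lemma eqv_add {e₁ e₂ f₁ f₂ : A} (he₁ : IsProjection e₁) (he₂ : IsProjection e₂)
    (hf₁ : IsProjection f₁) (hf₂ : IsProjection f₂) (he : e₁ * e₂ = 0) (hf : f₁ * f₂ = 0)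
    (h₁ : ProjEquiv e₁ f₁) (h₂ : ProjEquiv e₂ f₂) : ProjEquiv (e₁ + e₂) (f₁ + f₂) := by
  have he' := orth_comm he₁ he₂ he
  have hf' := orth_comm hf₁ hf₂ hf
  obtain ⟨v, a1, a2⟩ := h₁
  obtain ⟨w, b1, b2⟩ := h₂
  have v1 := pi_right G he₁ a1
  have w1 := pi_right G he₂ b1
  have v2 := pi_left G he₁ a1 a2
  have w2 := pi_left G he₂ b1 b2
  have v3 : star v * f₁ = star v := by simpa [hf₁.1] using congrArg star v2
  have w3 : star w * f₂ = star w := by simpa [hf₂.1] using congrArg star w2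
  have v4 : e₁ * star v = star v := by simpa [he₁.1] using congrArg star v1
  have w4 : e₂ * star w = star w := by simpa [he₂.1] using congrArg star w1
  have c1 : star v * w = 0 := by
    rw [← v3, ← w2, mul_assoc, ← mul_assoc f₁, hf]; simp
  have c2 : star w * v = 0 := by
    rw [← w3, ← v2, mul_assoc, ← mul_assoc f₂, hf']; simp
  have c3 : v * star w = 0 := by
    rw [← v1, ← w4, mul_assoc, ← mul_assoc e₁, he]; simp
  have c4 : w * star v = 0 := by
    rw [← w1, ← v4, mul_assoc, ← mul_assoc e₂, he']; simp
  refine ⟨v + w, ?_, ?_⟩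
  · rw [star_add, add_mul, mul_add, mul_add, a1, b1, c1, c2]; simp
  · rw [star_add, add_mul, mul_add, mul_add, a2, b2, c3, c4]; simp

/-- cutting a partial isometry -/
lemma cut {v e p : A} (hp : IsProjection p) (h : star v * v = e) (hpe : p * e = p) :
    IsProjection (v * p * star v) ∧ ProjEquiv p (v * p * star v) ∧
    (v * star v) * (v * p * star v) = v * p * star v ∧
     (v * p * star v) * (v * star v) = v * p * star v := by
  have he : star e = e := by rw [← h]; simp
  have hpe' : e * p = p := by simpa [he, hp.1] using congrArg star hpe
  have h1 : star (v * p) * (v * p) = p := by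
    rw [star_mul, hp.1, mul_assoc, ← mul_assoc (star v), h, hpe', hp.2]
  have h2 : (v * p) * star (v * p) = v * p * star v := by
    rw [star_mul, hp.1]; simp only [mul_assoc]; rw [← mul_assoc p p, hp.2]
  refine ⟨pi_proj G hp h1 h2, ⟨_, h1, h2⟩, ?_, ?_⟩
  · calc _ = v * ((star v * v) * p) * star v := by simp only [mul_assoc]
      _ = _ := by rw [h, hpe']
  · calc _ = v * (p * (star v * v)) * star v := by simp only [mul_assoc]
      _ = _ := by rw [h, hpe]

end

/-- annihilator version of supremum -/
def IsS {A : Type*} [Ring A] [StarRing A] {ι : Type*} (p : ι → A) (s : A) : Prop :=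
  IsProjection s ∧ (∀ i, p i * s = p i) ∧ ∀ x, (∀ i, p i * x = 0) → s * x = 0

section
variable {A : Type*} [Ring A] [StarRing A]

lemma IsS.unique {ι : Type*} {p : ι → A} {s t : A} (hs : IsS p s) (ht : IsS p t) : s = t := by
  have h1 : s * t = s := by
    have := hs.2.2 (1 - t) (fun i => by rw [mul_sub, ht.2.1]; simp)
    rw [mul_sub, mul_one, sub_eq_zero] at this; exact this.symm
  have h2 : t * s = t := by
    have := ht.2.2 (1 - s) (fun i => by rw [mul_sub, hs.2.1]; simp)
    rw [mul_sub, mul_one, sub_eq_zero] at this; exact this.symm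
  rw [← le_comm ht.1 hs.1 h2, h1]

lemma IsS.isSup {ι : Type*} {p : ι → A} {s : A} (hs : IsS p s) : IsSupProj p s := by
  refine ⟨hs.1, hs.2.1, fun t ht h => ?_⟩
  have := hs.2.2 (1 - t) (fun i => by rw [mul_sub, h i]; simp)
  rw [mul_sub, mul_one, sub_eq_zero] at this; exact this.symm

lemma IsS.reindex {ι κ : Type*} {p : ι → A} {s : A} (hs : IsS p s) (σ : κ ≃ ι) :
    IsS (fun k => p (σ k)) s :=
  ⟨hs.1, fun k => hs.2.1 _, fun x hx => hs.2.2 x fun i => by simpa using hx (σ.symm i)⟩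

lemma IsS.cmul {ι : Type*} {p : ι → A} {s z : A} (hs : IsS p s) (hz : IsCentralProj z) :
    IsS (fun k => z * p k) (z * s) := by
  refine ⟨cmul_proj hz hs.1, fun i => ?_, fun x hx => ?_⟩
  · calc z * p i * (z * s) = z * (p i * z) * s := by simp [mul_assoc]
      _ = (z * z) * (p i * s) := by rw [← hz.2]; simp [mul_assoc]
      _ = _ := by rw [hz.1.2, hs.2.1]
  · rw [hz.2, mul_assoc]
    exact hs.2.2 _ fun i => by rw [← mul_assoc, ← hz.2, hx]

lemma IsS.left {ι : Type*} {p : ι → A} {s : A} (hs : IsS p s) (hp : ∀ i, IsProjection (p i))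
   (i) : s * p i = p i := le_comm (hp i) hs.1 (hs.2.1 i)

/-- left annihilation -/
lemma IsS.orth {ι : Type*} {p : ι → A} {s t : A} (hs : IsS p s) (hp : ∀ i, IsProjection (p i))
    (ht : IsProjection t) (h : ∀ i, t * p i = 0) : t * s = 0 :=
  orth_comm hs.1 ht (hs.2.2 t fun i => orth_comm ht (hp i) (h i))

lemma IsS.orth2 {ι κ : Type*} {p : ι → A} {q : κ → A} {s t : A} (hs : IsS p s) (ht : IsS q t)
    (hq : ∀ i, IsProjection (q i)) (h : ∀ i j, p i * q j = 0) : s * t = 0 :=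
  ht.orth hq hs.1 fun j => hs.2.2 _ fun i => h i j

lemma IsS.le {ι : Type*} {p : ι → A} {s t : A} (hs : IsS p s)
    (h : ∀ i, p i * t = p i) : s * t = s := by
  have := hs.2.2 (1 - t) (fun i => by rw [mul_sub, h i]; simp)
  rw [mul_sub, mul_one, sub_eq_zero] at this; exact this.symm

lemma ann_central {p : A} (hp : IsProjection p) (h : ∀ a, p * (a * p) = a * p) :
    IsCentralProj p := by
  refine ⟨hp, fun a => ?_⟩
  have h2 := congrArg star (h (star a))
  simp only [star_mul, star_star, hp.1] at h2
  rw [← h2, mul_assoc, h]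

variable (G : Good A)
include G

lemma exists_sup {ι : Type*} (p : ι → A) : ∃ s, IsS p s := by
  obtain ⟨q, hq, h⟩ := G.aw (Set.range p)
  have hS : ∀ x, (∀ i, p i * x = 0) ↔ q * x = x := by
    intro x
    have := Set.ext_iff.1 h x
    simp only [Set.mem_range, forall_exists_index, forall_apply_eq_imp_iff, Set.mem_ofPred_eq] at this
    rw [this]
    constructor
    · rintro ⟨b, rfl⟩; rw [← mul_assoc, hq.2]
    · intro h; exact ⟨x, h.symm⟩
  refine ⟨1 - q, sub_proj hq one_proj (by simp), fun i => ?_, fun x hx => ?_⟩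
  · rw [mul_sub, (hS q).2 hq.2]; simp
  · rw [sub_mul, (hS x).1 hx]; simp

lemma exists_central_sup {ι : Type*} (p : ι → A) (hp : ∀ i, IsCentralProj (p i)) :
    ∃ s, IsS p s ∧ IsCentralProj s := by
  obtain ⟨s, hs⟩ := exists_sup G p
  refine ⟨s, hs, ?_⟩
  have h1 : IsCentralProj (1 - s) := by
    apply ann_central (sub_proj hs.1 one_proj (by simp))
    intro a
    have := hs.2.2 (a * (1 - s)) (fun i => by
      rw [← mul_assoc, (hp i).2, mul_assoc, mul_sub, hs.2.1]; simp)
    rw [sub_mul, this]; simp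
  simpa using compl_central h1

/-- Transport -/
lemma IsS.transport {ι : Type*} {p : ι → A} {s v f : A} (hs : IsS p s)
    (hp : ∀ i, IsProjection (p i))
    (hf : IsProjection f) (h : star v * v = f) (h' : v * star v = s) :
    IsS (fun i => star v * p i * v) f := by
  have v1 := pi_right G hf h
  have v2 := pi_left G hf h h'
  refine ⟨hf, fun i => by rw [mul_assoc, v1], fun x hx => ?_⟩
  have key : s * (v * x) = 0 := by
    refine hs.2.2 _ fun i => ?_
    have := congrArg (v * ·) (hx i)
    simp only [mul_zero] at this
    rw [← this]
    conv_lhs => rw [← hs.left hp i, ← h']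
    simp only [mul_assoc]
  rw [← mul_assoc, v2] at key
  rw [← h, mul_assoc, key, mul_zero]

lemma orth_add {ι : Type*} {p q : ι → A} {e f : A} (he : IsS p e) (hf : IsS q f)
    (hp : ∀ i, IsProjection (p i)) (hq : ∀ i, IsProjection (q i))
    (op : PairwiseOrthogonal p) (oq : PairwiseOrthogonal q) (opq : ∀ i j, p i * q j = 0)
    (h : ∀ i, ProjEquiv (p i) (q i)) : ProjEquiv e f := by
  choose w w1 w2 using h
  have oqp : ∀ i j, q i * p j = 0 := fun i j => orth_comm (hp j) (hq i) (opq j i)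
  obtain ⟨h, h1, h2, h3⟩ := G.half
  have wr : ∀ i, w i * p i = w i := fun i => pi_right G (hp i) (w1 i)
  have wl : ∀ i, q i * w i = w i := fun i => pi_left G (hp i) (w1 i) (w2 i)
  have wr' : ∀ i, p i * star (w i) = star (w i) := fun i => by
    simpa [(hp i).1] using congrArg star (wr i)
  have wl' : ∀ i, star (w i) * q i = star (w i) := fun i => by
    simpa [(hq i).1] using congrArg star (wl i)
  -- sums
  let k : ι → A := fun i => p i + q i
  let m : ι → A := fun i => w i + star (w i)
  have pw : ∀ i j, p i * w j = 0 := fun i j => by rw [← wl j, ← mul_assoc, opq]; simp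
  have wq : ∀ i j, w i * q j = 0 := fun i j => by rw [← wr i, mul_assoc, opq]; simp
  have qw : ∀ i j, q i * star (w j) = 0 := fun i j => by rw [← wr' j, ← mul_assoc, oqp]; simp
  have wp : ∀ i j, star (w i) * p j = 0 := fun i j => by rw [← wl' i, mul_assoc, oqp]; simp
  have ww : ∀ i j, w i * w j = 0 := fun i j => by rw [← wr i, mul_assoc, pw, mul_zero]
  have ww' : ∀ i j, star (w i) * star (w j) = 0 := fun i j => by
    rw [← wl' i, mul_assoc, qw, mul_zero]
  have kk : ∀ i, k i * k i = k i := fun i => by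
    simp only [k, mul_add, add_mul, (hp i).2, (hq i).2, opq, oqp]; simp
  have km : ∀ i, k i * m i = m i := fun i => by
    simp only [k, m, mul_add, add_mul, pw, qw, wl, wr']; abel
  have mk : ∀ i, m i * k i = m i := fun i => by
    simp only [k, m, mul_add, add_mul, wq, wp, wr, wl']; abel
  have mm : ∀ i, m i * m i = k i := fun i => by
    simp only [k, m, mul_add, add_mul, ww, ww', w1, w2]; abel
  have mo : ∀ i j, i ≠ j → m i * m j = 0 := fun i j hij => by
    have : w i * star (w j) = 0 := by
      rw [← wr i, ← wr' j, mul_assoc, ← mul_assoc (p i), op i j hij]; simp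
    have h' : star (w i) * (w j) = 0 := by
      rw [← wl' i, ← wl j, mul_assoc, ← mul_assoc (q i), oq i j hij]; simp
    simp only [m, mul_add, add_mul, ww, ww', this, h']; simp
  have sk : ∀ i, star (k i) = k i := fun i => by simp [k, (hp i).1, (hq i).1]
  have sm : ∀ i, star (m i) = m i := fun i => by simp [m, add_comm]
  have hh : ∀ a : A, h * a + h * a = a := fun a => by rw [← add_mul, h1, one_mul]
  let g : ι → A := fun i => h * (k i + m i)
  obtain ⟨γ, hγ⟩ := exists_sup G g
  have gproj : ∀ i, IsProjection (g i) := fun i => by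
    refine ⟨by simp only [g, star_mul, star_add, sk, sm, h2, h3], ?_⟩
    calc g i * g i = h * ((k i + m i) * h) * (k i + m i) := by simp only [g, mul_assoc]
      _ = h * (h * ((k i + m i) * (k i + m i))) := by rw [← h3]; simp only [mul_assoc]
      _ = h * (h * (k i + m i) + h * (k i + m i)) := by
        rw [← mul_add]; congr 2; simp only [mul_add, add_mul, kk, km, mk, mm]; abel
      _ = _ := by rw [hh]
  have gk : ∀ i, γ * (k i - m i) = 0 := fun i => hγ.2.2 _ fun j => by
    simp only [g, mul_assoc]
    by_cases hij : j = i
    · subst hij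
      simp only [mul_sub, add_mul, kk, km, mk, mm]; simp [add_comm]
    · have : k j * k i = 0 := by
        rw [← mm j, ← mm i, mul_assoc, ← mul_assoc (m j) (m i), mo j i hij]; simp
      have a : k j * m i = 0 := by
        rw [← mm j, mul_assoc, mo j i hij, mul_zero]
      have b : m j * k i = 0 := by
        rw [← mm i, ← mul_assoc, mo j i hij, zero_mul]
      simp [mul_sub, add_mul, this, a, b, mo j i hij]
  have gk2 : ∀ i, γ * (k i + m i) = k i + m i := fun i => by
    have := hγ.left gproj i
    calc _ = γ * (g i) + γ * (g i) := by rw [← mul_add]; simp only [g, hh]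
      _ = _ := by rw [this]; simp only [g, hh]
  let u : A := γ + γ - 1
  have su : star u = u := by simp [u, hγ.1.1]
  have uu : u * u = 1 := by simp only [u, mul_sub, sub_mul, mul_add, add_mul, hγ.1.2]; simp
  have uk : ∀ i, u * k i = m i := fun i => by
    have a := gk i; have b := gk2 i
    rw [mul_sub] at a; rw [mul_add] at b
    have : γ * k i = γ * m i := sub_eq_zero.1 a
    rw [← this] at b
    simp only [u, sub_mul, add_mul, b]; simp
  have up : ∀ i, u * p i = w i := fun i => by
    have : k i * p i = p i := by simp only [k, add_mul, (hp i).2, oqp]; simp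
    rw [← this, ← mul_assoc, uk]; simp only [m, add_mul, wr, wp]; simp
  refine ⟨u * e, ?_, ?_⟩
  · rw [star_mul, su, he.1.1, mul_assoc, ← mul_assoc u, uu, one_mul, he.1.2]
  · have e1 : star (star (u * e)) * star (u * e) = u * e * u := by
      simp [su, he.1.1, mul_assoc]; rw [← mul_assoc e e, he.1.2]
    have e2 : star (u * e) * star (star (u * e)) = e := by
      rw [star_star, star_mul, su, he.1.1, mul_assoc, ← mul_assoc u, uu, one_mul, he.1.2]
    have pr : IsProjection (u * e * u) := by
      refine ⟨by simp [su, he.1.1, mul_assoc], ?_⟩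
      calc _ = u * (e * (u * u) * e) * u := by simp only [mul_assoc]
        _ = _ := by rw [uu, mul_one, he.1.2]
    have := he.transport G hp pr e1 e2
    have e3 : (fun i => star (star (u * e)) * p i * star (u * e)) = q := by
      funext i
      rw [star_star, mul_assoc u, he.left hp, star_mul, he.1.1, su]
      calc u * p i * (e * u) = u * (p i * e) * u := by simp only [mul_assoc]
        _ = (u * (p i * p i)) * u := by rw [he.2.1, (hp i).2]
        _ = (u * p i) * star (u * p i) := by rw [star_mul, su, (hp i).1]; simp only [mul_assoc]
        _ = _ := by rw [up, w2]
    rw [e3] at this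
    have e4 : (u * e) * star (u * e) = u * e * u := by rw [← e1, star_star]
    rw [e4]
    exact this.unique hf

end

lemma good_of_cstar {A : Type*} [CStarAlgebra A] (aw : IsAWStarRing A) : 
   ∀ x : A, x ≠ 0 → ∃ y t : A, IsProjection (star (x * y) * (x * y)) ∧
    star (x * y) * (x * y) ≠ 0 ∧ star (x * y) * (x * y) = star x * t := by
  intro x hx
  set b : A := star x * x with hb
  have hsa : IsSelfAdjoint b := IsSelfAdjoint.star_mul_self x
  have hb0 : b ≠ 0 := fun h => hx ((CStarRing.star_mul_self_eq_zero_iff x).1 h)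
  have : Nontrivial A := ⟨x, 0, hx⟩
  have hn : 0 < ‖b‖ := norm_pos_iff.2 hb0
  have hspec : ‖b‖ ∈ spectrum ℝ b := by
    rcases CStarAlgebra.norm_or_neg_norm_mem_spectrum hsa with h | h
    · exact h
    · have := spectrum_star_mul_self_nonneg _ h
      linarith
  set ε : ℝ := ‖b‖ / 2 with hε
  have hε0 : 0 < ε := by positivity
  let u : ℝ → ℝ := fun t => max (t - ε) 0
  let w : ℝ → ℝ := fun t => max (ε - t) 0
  let k : ℝ → ℝ := fun t => (Real.sqrt (max t ε))⁻¹
  have cu : Continuous u := by fun_prop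
  have cw : Continuous w := by fun_prop
  have ck : Continuous k := by
    refine Continuous.inv₀ (by fun_prop) fun t => ?_
    have : 0 < max t ε := lt_max_of_lt_right hε0
    positivity
  have hwu : cfc w b * cfc u b = 0 := by
    rw [← cfc_mul w u b cw.continuousOn cu.continuousOn, ← cfc_zero (R := ℝ) (a := b)]
    apply cfc_congr
    intro t _
    simp only [u, w]
    rcases le_total t ε with h | h
    · rw [max_eq_right (by linarith : t - ε ≤ 0)]; simp
    · rw [max_eq_right (by linarith : ε - t ≤ 0)]; simp
  have hu0 : cfc u b ≠ 0 := by
    intro h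
    rw [← cfc_zero (R := ℝ) (a := b)] at h
    have := (cfc_eq_cfc_iff_eqOn hsa cu.continuousOn
      (continuous_zero (X := ℝ) (M := ℝ)).continuousOn).1 h hspec
    simp only [u] at this
    rw [max_eq_left (by linarith)] at this
    simp at this; linarith
  obtain ⟨p, hp, hS⟩ := aw {cfc w b}
  have hS' : ∀ a, cfc w b * a = 0 ↔ p * a = a := by
    intro a
    have := Set.ext_iff.1 hS a
    simp only [Set.mem_singleton_iff, forall_eq, Set.mem_ofPred_eq] at this
    rw [this]
    constructor
    · rintro ⟨c, rfl⟩; rw [← mul_assoc, hp.2]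
    · intro h; exact ⟨a, h.symm⟩
  have hp0 : p ≠ 0 := by
    rintro rfl
    apply hu0
    rw [← (hS' _).1 hwu]; simp
  have hwp : cfc w b * p = 0 := (hS' p).2 hp.2
  set h : A := cfc k b with hh
  have hsh : star h = h := IsSelfAdjoint.cfc
  have hph : p * (h * p) = h * p := (hS' _).1 (by
    rw [← mul_assoc, (cfc_commute_cfc w k b).eq, mul_assoc, hwp, mul_zero])
  have hph' : p * h * p = p * h := by
    have := congrArg star hph
    simpa [hp.1, hsh, mul_assoc] using this
  have hbh : b * (h * h) = 1 - ε⁻¹ • cfc w b := by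
    conv_lhs => rw [← cfc_id ℝ b]
    rw [hh, ← cfc_mul k k b ck.continuousOn ck.continuousOn,
      ← cfc_mul id (fun x => k x * k x) b continuousOn_id (ck.mul ck).continuousOn,
      ← cfc_smul _ _ _ cw.continuousOn, ← cfc_one ℝ b, ← cfc_sub 1 (fun x => ε⁻¹ • w x) b
       (continuous_one (X := ℝ) (M := ℝ)).continuousOn (show Continuous fun x => ε⁻¹ • w x by simp only [smul_eq_mul]; exact continuous_const.mul cw).continuousOn]
    apply cfc_congr
    intro t _
    have : 0 < max t ε := lt_max_of_lt_right hε0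
    simp only [k, w, id, Pi.one_apply, smul_eq_mul]
    rw [← mul_inv, Real.mul_self_sqrt this.le]
    rcases le_total t ε with h | h
    · rw [max_eq_right h, max_eq_left (by linarith)]; field_simp; ring
    · rw [max_eq_left h, max_eq_right (by linarith)]
      have : t ≠ 0 := by linarith
      field_simp; simp
  have hbhp : b * (h * h) * p = p := by
    rw [hbh, sub_mul, smul_mul_assoc, hwp]; simp
  have hbc : b * h = h * b := by
    have := (cfc_commute_cfc (id : ℝ → ℝ) k b).eq
    rwa [cfc_id ℝ b] at this
  have key : star (x * (h * p)) * (x * (h * p)) = p := by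
    calc _ = p * (h * (star x * x) * h * p) := by simp [hp.1, hsh, mul_assoc]
      _ = p * (b * (h * h) * p) := by rw [← hb, ← hbc]; simp only [mul_assoc]
      _ = p := by rw [hbhp, hp.2]
  refine ⟨h * p, x * (h * h) * p, ?_, ?_, ?_⟩
  · rw [key]; exact hp
  · rw [key]; exact hp0
  · rw [key, ← mul_assoc, ← mul_assoc, ← hb, hbhp]

structure Fam {A : Type*} [Ring A] [StarRing A] {K : Type*} (q : K → A) : Prop where
  proj : ∀ k, IsProjection (q k)
  orth : PairwiseOrthogonal q
  eqv : ∀ k l, ProjEquiv (q k) (q l)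

noncomputable def SS {A : Type*} [Ring A] [StarRing A] (G : Good A) {K : Type*} (q : K → A)
    (X : Set K) : A := Classical.choose (exists_sup G (fun k : X => q k))

lemma exists_halves {K : Type*} {X : Set K} (hX : X.Infinite) : ∃ X1 X2 : Set K,
    X = X1 ∪ X2 ∧ Disjoint X1 X2 ∧ Nonempty (X1 ≃ X) ∧ Nonempty (X2 ≃ X) := by
  have : Infinite X := hX.to_subtype
  obtain ⟨σ⟩ : Nonempty (X ⊕ X ≃ X) := by
    rw [← Cardinal.eq]; simp
  refine ⟨Set.range (fun x => (σ (Sum.inl x)).1), Set.range (fun x => (σ (Sum.inr x)).1),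
    ?_, ?_, ?_, ?_⟩
  · ext k
    constructor
    · intro hk
      obtain ⟨y, hy⟩ := σ.surjective ⟨k, hk⟩
      rcases y with y | y
      · left; exact ⟨y, congrArg Subtype.val hy⟩
      · right; exact ⟨y, congrArg Subtype.val hy⟩
    · rintro (⟨y, rfl⟩ | ⟨y, rfl⟩) <;> exact Subtype.coe_prop _
  · rw [Set.disjoint_left]
    rintro _ ⟨y, rfl⟩ ⟨z, hz⟩
    have := σ.injective (Subtype.ext hz)
    simp at this
  · exact ⟨(Equiv.ofInjective _ (fun a b h => by
      have := σ.injective (Subtype.ext h); simpa using this)).symm⟩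
  · exact ⟨(Equiv.ofInjective _ (fun a b h => by
      have := σ.injective (Subtype.ext h); simpa using this)).symm⟩

section
variable {A : Type*} [Ring A] [StarRing A] (G : Good A) {K : Type*} {q : K → A}
include G

lemma SS_spec (q : K → A) (X : Set K) : IsS (fun k : X => q k) (SS G q X) :=
  Classical.choose_spec (exists_sup G (fun k : X => q k))

lemma SS_proj (q : K → A) (X : Set K) : IsProjection (SS G q X) := (SS_spec G q X).1

lemma SS_univ {s : A} (h : IsS q s) : SS G q Set.univ = s :=
  (SS_spec G q Set.univ).unique (h.reindex (Equiv.Set.univ K))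

lemma SS_orth (hq : Fam q) {X Y : Set K} (h : Disjoint X Y) : SS G q X * SS G q Y = 0 :=
  (SS_spec G q X).orth2 (SS_spec G q Y) (fun _ => hq.proj _) fun i j => hq.orth _ _ fun hij =>
    Set.disjoint_left.1 h i.2 (hij ▸ j.2)

lemma SS_union (hq : Fam q) {X Y : Set K} (h : Disjoint X Y) :
    SS G q (X ∪ Y) = SS G q X + SS G q Y := by
  refine (SS_spec G q (X ∪ Y)).unique ⟨add_proj (SS_proj G q X) (SS_proj G q Y)
    (SS_orth G hq h), ?_, ?_⟩
  · rintro ⟨k, hk | hk⟩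
    · have h1 := (SS_spec G q X).2.1 ⟨k, hk⟩
      have h2 : q k * SS G q Y = 0 := (SS_spec G q Y).orth (fun _ => hq.proj _) (hq.proj k)
        fun j => hq.orth _ _ fun hij => Set.disjoint_left.1 h hk (hij ▸ j.2)
      simp only at h1
      rw [mul_add, h1, h2, add_zero]
    · have h1 := (SS_spec G q Y).2.1 ⟨k, hk⟩
      have h2 : q k * SS G q X = 0 := (SS_spec G q X).orth (fun _ => hq.proj _) (hq.proj k)
        fun j => hq.orth _ _ fun hij => Set.disjoint_left.1 h j.2 (hij ▸ hk)
      simp only at h1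
      rw [mul_add, h1, h2, zero_add]
  · intro x hx
    rw [add_mul, (SS_spec G q X).2.2 x fun i => hx ⟨i.1, Or.inl i.2⟩,
      (SS_spec G q Y).2.2 x fun i => hx ⟨i.1, Or.inr i.2⟩, add_zero]

lemma F0 (hq : Fam q) {X Y : Set K} (h : Disjoint X Y) (σ : X ≃ Y) :
    ProjEquiv (SS G q X) (SS G q Y) := by
  refine orth_add G (SS_spec G q X) ((SS_spec G q Y).reindex σ) (fun _ => hq.proj _)
    (fun _ => hq.proj _) (fun i j hij => hq.orth _ _ fun h => hij (Subtype.ext h))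
    (fun i j hij => hq.orth _ _ fun h => hij (σ.injective (Subtype.ext h)))
    (fun i j => hq.orth _ _ fun hij => Set.disjoint_left.1 h i.2 (hij ▸ (σ j).2))
    (fun i => hq.eqv _ _)

lemma F3 (hq : Fam q) {X : Set K} (hX : X.Infinite) {k : K} (hk : k ∉ X) :
    ProjEquiv (SS G q (insert k X)) (SS G q X) := by
  obtain ⟨X1, X2, rfl, hd, ⟨σ1⟩, ⟨σ2⟩⟩ := exists_halves hX
  have hI : Infinite (X1 ∪ X2 : Set K) := hX.to_subtype
  have : Infinite X1 := Infinite.of_injective σ1.symm σ1.symm.injective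
  have hk1 : k ∉ X1 := fun h => hk (Or.inl h)
  have hk2 : k ∉ X2 := fun h => hk (Or.inr h)
  obtain ⟨τ⟩ : Nonempty ((insert k X1 : Set K) ≃ X1) := by
    rw [← Cardinal.eq, Cardinal.mk_insert hk1, Cardinal.add_one_eq (Cardinal.aleph0_le_mk _)]
  have hd' : Disjoint (insert k X1) X2 := by
    rw [Set.disjoint_insert_left]; exact ⟨hk2, hd⟩
  have e1 : ProjEquiv (SS G q (insert k X1)) (SS G q X2) :=
    F0 G hq hd' (τ.trans (σ1.trans σ2.symm))
  have e2 : ProjEquiv (SS G q X2) (SS G q X1) := F0 G hq hd.symm (σ2.trans σ1.symm)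
  rw [← Set.insert_union, SS_union G hq hd', Set.union_comm, SS_union G hq hd.symm]
  exact eqv_add G (SS_proj G q _) (SS_proj G q _) (SS_proj G q _) (SS_proj G q _)
    (SS_orth G hq hd') (SS_orth G hq hd.symm) e1 e2

lemma F2 (hq : Fam q) {X : Set K} (hX : X.Infinite) (σ : (Xᶜ : Set K) ≃ X) :
    ProjEquiv (SS G q Set.univ) (SS G q X) := by
  obtain ⟨X1, X2, hXX, hd, ⟨σ1⟩, ⟨σ2⟩⟩ := exists_halves hX
  have d1 : Disjoint Xᶜ X1 := by
    rw [Set.disjoint_left]; intro a ha hb; apply ha; rw [hXX]; exact Or.inl hb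
  have d2 : Disjoint Xᶜ X2 := by
    rw [Set.disjoint_left]; intro a ha hb; apply ha; rw [hXX]; exact Or.inr hb
  have d3 : Disjoint Xᶜ X := disjoint_compl_left
  have e1 : ProjEquiv (SS G q Xᶜ) (SS G q X1) := F0 G hq d1 (σ.trans σ1.symm)
  have e2 : ProjEquiv (SS G q Xᶜ) (SS G q X2) := F0 G hq d2 (σ.trans σ2.symm)
  have e3 : ProjEquiv (SS G q X) (SS G q Xᶜ) := F0 G hq d3.symm σ.symm
  have e4 := eqv_trans (SS_proj G q _) (SS_proj G q _) e3 e2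
  have e5 : SS G q X = SS G q X1 + SS G q X2 := by
    conv_lhs => rw [hXX]
    exact SS_union G hq hd
  rw [← Set.compl_union_self X, SS_union G hq d3]
  conv_rhs => rw [e5]
  exact eqv_add G (SS_proj G q _) (SS_proj G q _) (SS_proj G q _) (SS_proj G q _)
    (SS_orth G hq d3) (SS_orth G hq hd) e1 e4

end

lemma Fam.reindex {A : Type*} [Ring A] [StarRing A] {I J : Type*} {q : I → A} (hq : Fam q) (σ : J ≃ I) :
    Fam (fun j => q (σ j)) :=
  ⟨fun _ => hq.proj _, fun _ _ h => hq.orth _ _ fun h' => h (σ.injective h'),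
    fun _ _ => hq.eqv _ _⟩

def MM {A : Type*} [Ring A] [StarRing A] (I : Type*) (f : A) : Prop :=
  ∃ p : I → A, Fam p ∧ IsS p f

section
variable {A : Type*} [Ring A] [StarRing A] (G : Good A) {K : Type*} {q : K → A}
include G

lemma fibers {I J : Type*} {q : I × J → A} {f : A} (hq : Fam q) (hf : IsS q f) :
    Fam (fun i => SS G q {x | x.1 = i}) ∧ IsS (fun i => SS G q {x | x.1 = i}) f := by
  have hd : ∀ i j : I, i ≠ j → Disjoint {x : I × J | x.1 = i} {x | x.1 = j} := by
    intro i j hij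
    rw [Set.disjoint_left]; rintro x rfl h; exact hij h
  have eq : ∀ i j : I, Nonempty ({x : I × J | x.1 = i} ≃ {x : I × J | x.1 = j}) := fun i j =>
    ⟨⟨fun x => ⟨(j, x.1.2), rfl⟩, fun x => ⟨(i, x.1.2), rfl⟩,
      by rintro ⟨⟨a, b⟩, rfl⟩; rfl, by rintro ⟨⟨a, b⟩, rfl⟩; rfl⟩⟩
  refine ⟨⟨fun i => SS_proj G q _, fun i j hij => SS_orth G hq (hd i j hij), fun i j => ?_⟩,
    hf.1, fun i => ?_, fun x hx => ?_⟩
  · by_cases hij : i = j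
    · subst hij; exact eqv_refl (SS_proj G q _)
    · exact F0 G hq (hd i j hij) (eq i j).some
  · exact (SS_spec G q _).le fun k => hf.2.1 _
  · refine hf.2.2 x fun k => ?_
    have h1 := hx k.1
    have h2 := (SS_spec G q {x | x.1 = k.1}).2.1 ⟨k, rfl⟩
    simp only at h1 h2
    rw [← h2, mul_assoc, h1, mul_zero]

lemma MM_mono {I J : Type*} (σ : I × J ≃ J) {f : A} (h : MM J f) : MM I f := by
  obtain ⟨q, hq, hf⟩ := h
  have := fibers G (hq.reindex σ) (hf.reindex σ)
  exact ⟨_, this.1, this.2⟩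

lemma MM_gamma' {I : Type*} [Infinite I] {f : A} (h : MM I f) :
    ∃ p : I → A, Fam p ∧ IsS p f ∧ ∀ i, ProjEquiv (p i) f := by
  obtain ⟨σ⟩ : Nonempty (I × I ≃ I) := by
    rw [← Cardinal.eq]; simp
  obtain ⟨q', hq', hf'⟩ := h
  have hq := hq'.reindex σ
  have hf := hf'.reindex σ
  set q : I × I → A := fun j => q' (σ j) with hqd
  have := fibers G hq hf
  refine ⟨_, this.1, this.2, fun i => eqv_symm ?_⟩
  have hX : Nonempty (I ≃ {x : I × I | x.1 = i}) :=
    ⟨⟨fun j => ⟨(i, j), rfl⟩, fun x => x.1.2, fun _ => rfl, by rintro ⟨⟨a, b⟩, rfl⟩; rfl⟩⟩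
  have e1 : Infinite {x : I × I | x.1 = i} :=
    Infinite.of_injective _ hX.some.injective
  have e2 : Nonempty (({x : I × I | x.1 = i}ᶜ : Set (I × I)) ≃ {x : I × I | x.1 = i}) := by
    rw [← Cardinal.eq, ← Cardinal.eq.2 hX]
    apply le_antisymm
    · exact (Cardinal.mk_set_le _).trans (le_of_eq (Cardinal.eq.2 ⟨σ⟩))
    · obtain ⟨i', hi'⟩ := exists_ne i
      exact Cardinal.mk_le_of_injective (f := fun j => ⟨(i', j), hi'⟩) (fun a b h => by
        simpa using h)
  have := F2 G hq (Set.infinite_coe_iff.1 e1) e2.some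
  rwa [SS_univ G hf] at this

lemma MM_transport {I : Type*} {s f : A} (hf : IsProjection f)
    (h : ProjEquiv f s) (hs : MM I s) : MM I f := by
  obtain ⟨p, hp, hps⟩ := hs
  obtain ⟨v, h1, h2⟩ := h
  have hc := fun i => cut G (v := star v) (hp.proj i) (by simpa using h2) (hps.2.1 i)
  simp only [star_star] at hc
  refine ⟨_, ⟨fun i => (hc i).1, fun i j hij => ?_, fun i j => ?_⟩,
    hps.transport G hp.proj hf h1 h2⟩
  · calc _ = star v * (p i * (v * star v * p j)) * v := by simp only [mul_assoc]
      _ = 0 := by rw [h2, hps.left hp.proj, hp.orth i j hij]; simp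
  · exact eqv_trans (hc i).1 (hc j).1 (eqv_symm (hc i).2.1)
      (eqv_trans (hp.proj i) (hc j).1 (hp.eqv i j) (hc j).2.1)

lemma absorb {J : Type*} [Infinite J] {g : J → A} {s r : A} (hg : Fam g) (hs : IsS g s)
    (hr : IsProjection r) (hrs : r * s = 0) (j0 : J) (h : ProjSubEquiv r (g j0)) :
    ProjEquiv (r + s) s := by
  obtain ⟨r0, hr0, hr0g, hrr⟩ := h
  have : ∀ j, ∃ r', IsProjection r' ∧ r' * g j = r' ∧ ProjEquiv r r' := by
    intro j
    obtain ⟨v, h1, h2⟩ := hg.eqv j0 j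
    have hc := cut G hr0 h1 hr0g
    refine ⟨_, hc.1, ?_, eqv_trans hr hc.1 hrr hc.2.1⟩
    rw [← h2]; exact hc.2.2.2
  choose t t1 t2 t3 using this
  let q : Option J → A := fun k => k.elim r t
  have ts : ∀ j, t j * s = t j := fun j => by rw [← t2 j, mul_assoc, hs.2.1]
  have rt : ∀ j, r * t j = 0 := fun j => by
    rw [← le_comm (t1 j) hs.1 (ts j), ← mul_assoc, hrs, zero_mul]
  have tt : ∀ i j, i ≠ j → t i * t j = 0 := fun i j hij => by
    rw [← t2 i, ← le_comm (t1 j) (hg.proj j) (t2 j), mul_assoc, ← mul_assoc (g i),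
      hg.orth i j hij]; simp
  have hqp : ∀ k, IsProjection (q k) := by
    rintro (_ | j)
    · exact hr
    · exact t1 j
  have hqr : ∀ k, ProjEquiv r (q k) := by
    rintro (_ | j)
    · exact eqv_refl hr
    · exact t3 j
  have hq : Fam q := by
    refine ⟨hqp, ?_, fun k l => eqv_trans (hqp k) (hqp l) (eqv_symm (hqr k)) (hqr l)⟩
    rintro (_ | i) (_ | j) hij
    · exact absurd rfl hij
    · exact rt j
    · exact orth_comm hr (t1 i) (rt i)
    · exact tt i j fun h => hij (by rw [h])
  let X : Set (Option J) := Set.range some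
  have hX : X.Infinite := Set.infinite_range_of_injective (Option.some_injective J)
  have hn : none ∉ X := by simp [X]
  have hF := F3 G hq hX hn
  have hd : Disjoint {none} X := by simpa using hn
  rw [Set.insert_eq, SS_union G hq hd] at hF
  have h1 : SS G q {none} = r := by
    refine (SS_spec G q {none}).unique ⟨hr, ?_, ?_⟩
    · rintro ⟨_, rfl⟩; exact hr.2
    · intro x hx; exact hx ⟨none, rfl⟩
  rw [h1] at hF
  set ρ := SS G q X with hρ
  have ρp : IsProjection ρ := SS_proj G q X
  have ρs : ρ * s = ρ := (SS_spec G q X).le (by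
    rintro ⟨_, j, rfl⟩; exact ts j)
  have ρs' := le_comm ρp hs.1 ρs
  have rρ : r * ρ = 0 := by rw [← ρs', ← mul_assoc, hrs, zero_mul]
  have a1 : (r + ρ) * (s - ρ) = 0 := by
    rw [add_mul, mul_sub, mul_sub, hrs, rρ, ρs, ρp.2]; simp
  have a2 : ρ * (s - ρ) = 0 := by rw [mul_sub, ρs, ρp.2]; simp
  have sp := sub_proj ρp hs.1 ρs
  have := eqv_add G (add_proj hr ρp rρ) sp ρp sp a1 a2 hF (eqv_refl sp)
  simpa [add_assoc] using this

end

lemma exists_max {T : Type*} (P : T → Prop) (R : T → T → Prop) (S0 : Set T)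
    (h0 : ∀ x ∈ S0, P x) (h1 : S0.Pairwise R) : ∃ S, S0 ⊆ S ∧ (∀ x ∈ S, P x) ∧ S.Pairwise R ∧
    ∀ x, P x → (∀ y ∈ S, R x y ∧ R y x) → x ∈ S := by
  obtain ⟨m, hm, hmax⟩ := zorn_subset_nonempty {S : Set T | (∀ x ∈ S, P x) ∧ S.Pairwise R}
    (by
      intro c hc hch _
      refine ⟨⋃₀ c, ⟨?_, ?_⟩, fun s hs => Set.subset_sUnion_of_mem hs⟩
      · rintro x ⟨s, hs, hx⟩; exact (hc hs).1 x hx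
      · exact (Set.pairwise_sUnion hch.directedOn).2 fun s hs => (hc hs).2) S0 ⟨h0, h1⟩
  refine ⟨m, hm, hmax.prop.1, hmax.prop.2, fun x hx hR => ?_⟩
  have : insert x m ∈ {S : Set T | (∀ x ∈ S, P x) ∧ S.Pairwise R} := by
    refine ⟨?_, hmax.prop.2.insert fun y hy _ => hR y hy⟩
    rintro y (rfl | hy)
    · exact hx
    · exact hmax.prop.1 y hy
  exact hmax.le_of_ge this (Set.subset_insert x m) (Set.mem_insert x m)

lemma cmul_le {A : Type*} [Ring A] [StarRing A] {z e f : A} (hz : IsCentralProj z)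
    (h : e * f = e) : z * e * (z * f) = z * e := by
  calc z * e * (z * f) = z * (e * z) * f := by simp [mul_assoc]
    _ = (z * z) * (e * f) := by rw [← hz.2]; simp [mul_assoc]
    _ = _ := by rw [hz.1.2, h]

lemma le_of_left {A : Type*} [Ring A] [StarRing A] {e f : A} (he : IsProjection e)
    (hf : IsProjection f) (h : f * e = e) : e * f = e := by
  have := congrArg star h
  simpa [he.1, hf.1] using this

section
variable {A : Type*} [Ring A] [StarRing A] (G : Good A)
include G

lemma compar {r g : A} (hr : IsProjection r) (hg : IsProjection g) (hrg : r * g = 0) :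
    ∃ z, IsCentralProj z ∧ ProjSubEquiv (z * r) (z * g) ∧
      ProjSubEquiv ((1 - z) * g) ((1 - z) * r) := by
  obtain ⟨S, -, hS, hSR, hmax⟩ := exists_max
    (fun x : A × A => IsProjection x.1 ∧ IsProjection x.2 ∧ x.1 * r = x.1 ∧ x.2 * g = x.2 ∧
      ProjEquiv x.1 x.2) (fun x y => x.1 * y.1 = 0 ∧ x.2 * y.2 = 0) ∅ (by simp) (by simp)
  let p : S → A := fun j => j.1.1
  let q : S → A := fun j => j.1.2
  obtain ⟨r', hr'⟩ := exists_sup G p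
  obtain ⟨g', hg'⟩ := exists_sup G q
  have pp : ∀ j, IsProjection (p j) := fun j => (hS _ j.2).1
  have qp : ∀ j, IsProjection (q j) := fun j => (hS _ j.2).2.1
  have pr : ∀ j, p j * r = p j := fun j => (hS _ j.2).2.2.1
  have qg : ∀ j, q j * g = q j := fun j => (hS _ j.2).2.2.2.1
  have heq : ProjEquiv r' g' := by
    refine orth_add G hr' hg' pp qp (fun i j hij => ?_) (fun i j hij => ?_) (fun i j => ?_)
      (fun j => (hS _ j.2).2.2.2.2)
    · exact (hSR i.2 j.2 fun h => hij (Subtype.ext h)).1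
    · exact (hSR i.2 j.2 fun h => hij (Subtype.ext h)).2
    · rw [← pr i, ← le_comm (qp j) hg (qg j), mul_assoc, ← mul_assoc r, hrg]; simp
  have hr'r : r' * r = r' := hr'.le pr
  have hg'g : g' * g = g' := hg'.le qg
  have rr' := le_comm hr'.1 hr hr'r
  have gg' := le_comm hg'.1 hg hg'g
  have hr2 := sub_proj hr'.1 hr hr'r
  have hg2 := sub_proj hg'.1 hg hg'g
  have key : ∀ a, (r - r') * a * (g - g') = 0 := by
    intro a
    by_contra hx
    obtain ⟨y, t, hp, hp0, hpt⟩ := G.eq _ hx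
    set x := (r - r') * a * (g - g') with hxd
    set v := x * y with hv
    have sx : star x = (g - g') * (star a * (r - r')) := by
      rw [hxd, star_mul, star_mul, hg2.1, hr2.1]
    have h1 : (r - r') * v = v := by
      rw [hv, hxd]
      simp only [← mul_assoc]; rw [hr2.2]
    have h2 : (g - g') * (star v * v) = star v * v := by
      rw [hpt, sx]; simp only [← mul_assoc]; rw [hg2.2]
    have h3 : (r - r') * (v * star v) = v * star v := by rw [← mul_assoc, h1]
    have hb : IsProjection (v * star v) := pi_proj G hp rfl rfl
    have hmem : (v * star v, star v * v) ∈ S := by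
      apply hmax
      · refine ⟨hb, hp, le_of_left hb hr ?_, le_of_left hp hg ?_, eqv_symm ⟨v, rfl, rfl⟩⟩
        · simp only
          rw [← h3, ← mul_assoc, mul_sub, hr.2, rr']
        · simp only
          rw [← h2, ← mul_assoc, mul_sub, hg.2, gg']
      · intro w hw
        have a1 : w.1 * (v * star v) = 0 := by
          have := hr'.2.1 ⟨w, hw⟩
          have h' := pr ⟨w, hw⟩
          simp only [p] at this h'
          rw [← h3, ← mul_assoc, mul_sub, this, h']; simp
        have a2 : w.2 * (star v * v) = 0 := by
          have := hg'.2.1 ⟨w, hw⟩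
          have h' := qg ⟨w, hw⟩
          simp only [q] at this h'
          rw [← h2, ← mul_assoc, mul_sub, this, h']; simp
        exact ⟨⟨orth_comm (hS w hw).1 hb a1, orth_comm (hS w hw).2.1 hp a2⟩, a1, a2⟩
    have a2 : star v * v = 0 := by
      have := hg'.2.1 ⟨_, hmem⟩
      have h' := qg ⟨_, hmem⟩
      simp only [q] at this h'
      have h4 : star v * v * (star v * v) = 0 := by
        nth_rw 2 [← h2]
        rw [← mul_assoc, mul_sub, this, h']; simp
      rwa [hp.2] at h4
    exact hp0 a2
  obtain ⟨z, hz, hzS⟩ := G.aw {x | ∃ a, x = (r - r') * a}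
  have hz' : ∀ x, (∀ a, (r - r') * a * x = 0) ↔ z * x = x := by
    intro x
    have := Set.ext_iff.1 hzS x
    simp only [Set.mem_ofPred_eq, forall_exists_index, forall_eq_apply_imp_iff] at this
    rw [this]
    constructor
    · rintro ⟨c, rfl⟩; rw [← mul_assoc, hz.2]
    · intro h; exact ⟨x, h.symm⟩
  have zc : IsCentralProj z := by
    refine ann_central hz fun b => (hz' _).1 fun a => ?_
    have := (hz' z).2 hz.2 (a * b)
    rw [← this]; simp only [mul_assoc]
  have z1 : z * (g - g') = g - g' := (hz' _).1 key
  have z2 : z * (r - r') = 0 := by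
    rw [zc.2]; simpa using (hz' z).2 hz.2 1
  have z3 : z * r = z * r' := by rw [mul_sub] at z2; exact sub_eq_zero.1 z2
  have z4 : (1 - z) * g = (1 - z) * g' := by
    apply sub_eq_zero.1; rw [← mul_sub, sub_mul, z1]; simp
  refine ⟨z, zc, ?_, ?_⟩
  · rw [z3]
    exact ⟨z * g', cmul_proj zc hg'.1, cmul_le zc hg'g, cmul_eqv zc heq⟩
  · rw [z4]
    have zc' := compl_central zc
    exact ⟨(1 - z) * r', cmul_proj zc' hr'.1, cmul_le zc' hr'r, cmul_eqv zc' (eqv_symm heq)⟩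
end

section
universe w
variable {A : Type w} [Ring A] [StarRing A] (G : Good A)
include G

lemma local_step {I : Type w} [Infinite I] {f : A} (hf : IsProjection f) (g : I → A)
    (hg : Fam g) (hg0 : ∀ i, g i ≠ 0) (hgf : ∀ i, g i * f = g i) :
    ∃ z, IsCentralProj z ∧ z * f ≠ 0 ∧ MM I (z * f) := by
  obtain ⟨i0⟩ : Nonempty I := inferInstance
  obtain ⟨S, hS0, hS, hSR, hmax⟩ := exists_max
    (fun x : A => IsProjection x ∧ x * f = x ∧ ProjEquiv (g i0) x)
    (fun x y => x * y = 0) (Set.range g)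
    (by rintro _ ⟨i, rfl⟩; exact ⟨hg.proj i, hgf i, hg.eqv i0 i⟩)
    (by
      rintro _ ⟨i, rfl⟩ _ ⟨j, rfl⟩ hij
      exact hg.orth i j fun h => hij (by rw [h]))
  have ginj : Function.Injective g := by
    intro i j hij
    by_contra h
    have := hg.orth i j h
    rw [← hij, (hg.proj i).2] at this
    exact hg0 i this
  let σ : I → S := fun i => ⟨g i, hS0 ⟨i, rfl⟩⟩
  have σi : Function.Injective σ := fun i j h => ginj (congrArg Subtype.val h)
  have : Infinite S := Infinite.of_injective σ σi
  obtain ⟨τ⟩ : Nonempty (I × S ≃ S) := by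
    rw [← Cardinal.eq]
    simp only [Cardinal.mk_prod, Cardinal.lift_id]
    exact Cardinal.mul_eq_right (Cardinal.aleph0_le_mk _) (Cardinal.mk_le_of_injective σi)
      (Cardinal.mk_ne_zero I)
  let p : S → A := fun x => x.1
  have pF : Fam p := ⟨fun x => (hS _ x.2).1, fun x y hxy => hSR x.2 y.2 fun h =>
    hxy (Subtype.ext h), fun x y => eqv_trans (hS _ x.2).1 (hS _ y.2).1
      (eqv_symm (hS _ x.2).2.2) (hS _ y.2).2.2⟩
  obtain ⟨s, hs⟩ := exists_sup G p
  have hsf : s * f = s := hs.le fun x => (hS _ x.2).2.1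
  have hfs := le_comm hs.1 hf hsf
  have hr := sub_proj hs.1 hf hsf
  have hrs : (f - s) * s = 0 := by rw [sub_mul, hfs, hs.1.2]; simp
  have hgs : g i0 * s = g i0 := hs.2.1 (σ i0)
  have hrg : (f - s) * g i0 = 0 := by
    rw [← le_comm (hg.proj i0) hs.1 hgs, ← mul_assoc, hrs, zero_mul]
  obtain ⟨z, hz, h1, h2⟩ := compar G hr (hg.proj i0) hrg
  have hzg : z * g i0 ≠ 0 := by
    intro h0
    obtain ⟨e, he, he1, he2⟩ := h2
    have hg' : (1 - z) * g i0 = g i0 := by rw [sub_mul, h0]; simp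
    rw [hg'] at he2
    have hc := compl_central hz
    have e1 : e * (f - s) = e := by
      have he1' : e * ((1 - z) * (f - s)) = e := he1
      conv_lhs => rw [← he1']
      rw [mul_assoc, mul_assoc, hr.2]
      exact he1'
    have es : e * s = 0 := by rw [← e1, mul_assoc, hrs, mul_zero]
    have ef : e * f = e := by rw [mul_sub, es, sub_zero] at e1; exact e1
    have hmem : e ∈ S := by
      apply hmax
      · exact ⟨he, ef, he2⟩
      · intro y hy
        have : e * y = 0 := by
          have h8 : s * y = y := hs.left pF.proj ⟨y, hy⟩
          rw [← h8, ← mul_assoc, es, zero_mul]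
        exact ⟨this, orth_comm he (hS y hy).1 this⟩
    have : e * s = e := hs.2.1 ⟨e, hmem⟩
    rw [es] at this
    exact eqv_ne G he2 (hg0 i0) this.symm
  refine ⟨z, hz, ?_, ?_⟩
  · intro h0
    apply hzg
    rw [← le_comm (hg.proj i0) hf (hgf i0), ← mul_assoc, h0, zero_mul]
  · apply MM_mono G τ
    have zF : Fam (fun x => z * p x) := by
      refine ⟨fun x => cmul_proj hz (pF.proj x), fun x y hxy => ?_, fun x y =>
        cmul_eqv hz (pF.eqv x y)⟩
      calc z * p x * (z * p y) = z * (p x * z) * p y := by simp only [mul_assoc]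
        _ = z * z * (p x * p y) := by rw [← hz.2]; simp only [mul_assoc]
        _ = 0 := by rw [pF.orth x y hxy, mul_zero]
    have zs := hs.cmul hz
    have zrs : z * (f - s) * (z * s) = 0 := by
      calc z * (f - s) * (z * s) = z * ((f - s) * z) * s := by simp only [mul_assoc]
        _ = z * z * ((f - s) * s) := by rw [← hz.2]; simp only [mul_assoc]
        _ = 0 := by rw [hrs, mul_zero]
    have := absorb G zF zs (cmul_proj hz hr) zrs (σ i0) h1
    rw [← mul_add, sub_add_cancel] at this
    exact MM_transport G (cmul_proj hz hf) this ⟨_, zF, zs⟩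

lemma global_step {I : Type w} [Infinite I] {f : A} (hf : IsProjection f)
    (H : ∀ z, IsCentralProj z → z * f ≠ 0 → ∃ g : I → A, Fam g ∧ (∀ i, g i ≠ 0) ∧
      ∀ i, g i * (z * f) = g i) : MM I f := by
  obtain ⟨S, -, hS, hSR, hmax⟩ := exists_max
    (fun z : A => IsCentralProj z ∧ MM I (z * f))
    (fun x y => x * y = 0) ∅ (by simp) (by simp)
  obtain ⟨y, hy, hyc⟩ := exists_central_sup G (fun z : S => z.1) (fun z => (hS _ z.2).1)
  have hyf : y * f = f := by
    by_contra hne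
    have hc := compl_central hyc
    have hcf : (1 - y) * f ≠ 0 := by
      intro h; rw [sub_mul, one_mul, sub_eq_zero] at h; exact hne h.symm
    obtain ⟨g, hg, hg0, hgf⟩ := H _ hc hcf
    obtain ⟨z, hz, hz0, hzM⟩ := local_step G (cmul_proj hc hf) g hg hg0 hgf
    rw [← mul_assoc] at hz0 hzM
    have hzc := mul_central hz hc
    have hmem : z * (1 - y) ∈ S := by
      refine hmax _ ⟨hzc, hzM⟩ fun x hx => ?_
      have : x * (z * (1 - y)) = 0 := by
        have h1 : x * y = x := hy.2.1 ⟨x, hx⟩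
        rw [hz.2, ← mul_assoc, mul_sub, h1]; simp
      exact ⟨by rw [hzc.2]; exact this, this⟩
    have h1 : z * (1 - y) * y = z * (1 - y) := hy.2.1 ⟨_, hmem⟩
    rw [mul_assoc, sub_mul, one_mul, hyc.1.2, sub_self, mul_zero] at h1
    rw [← h1, zero_mul] at hz0
    exact hz0 rfl
  choose P hP hPs using fun z : S => (hS _ z.2).2
  have zP : ∀ z i, z.1 * P z i = P z i := fun z i => by
    have h1 := (hPs z).left (hP z).proj i
    rw [← h1, mul_assoc, ← mul_assoc, ← mul_assoc, (hS _ z.2).1.1.2, mul_assoc]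
  have cross : ∀ z z' i i', z ≠ z' → P z i * P z' i' = 0 := fun z z' i i' h => by
    rw [← zP z i, ← zP z' i', (hS _ z.2).1.2, mul_assoc, ← mul_assoc z.1,
      hSR z.2 z'.2 fun h' => h (Subtype.ext h')]
    simp
  choose s hs using fun i => exists_sup G (fun z : S => P z i)
  have sorth : ∀ i j, i ≠ j → ∀ z z', P z i * P z' j = 0 := by
    intro i j hij z z'
    by_cases h : z = z'
    · subst h; exact (hP z).orth i j hij
    · exact cross z z' i j h
  refine ⟨s, ⟨fun i => (hs i).1, fun i j hij => ?_, fun i j => ?_⟩, hf, fun i => ?_,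
    fun x hx => ?_⟩
  · exact (hs i).orth2 (hs j) (fun z => (hP z).proj j) (sorth i j hij)
  · by_cases hij : i = j
    · subst hij; exact eqv_refl (hs i).1
    · exact orth_add G (hs i) (hs j) (fun z => (hP z).proj i) (fun z => (hP z).proj j)
        (fun z z' h => cross z z' i i h) (fun z z' h => cross z z' j j h) (sorth i j hij)
        (fun z => (hP z).eqv i j)
  · refine (hs i).le fun z => ?_
    have := (hPs z).2.1 i
    rw [← this, mul_assoc, mul_assoc, hf.2]
  · rw [← hyf, mul_assoc]
    refine hy.2.2 _ fun z => ?_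
    rw [← mul_assoc]
    refine (hPs z).2.2 x fun i => ?_
    have h1 : P z i * s i = P z i := (hs i).2.1 z
    rw [← h1, mul_assoc, hx, mul_zero]

lemma global_gamma {I : Type w} [Infinite I] {f : A} (hf : IsProjection f)
    (H : ∀ z, IsCentralProj z → z * f ≠ 0 → ∃ g : I → A, Fam g ∧ (∀ i, g i ≠ 0) ∧
      ∀ i, g i * (z * f) = g i) : ∃ p : I → A, InGamma f p := by
  obtain ⟨p, hp, hs, he⟩ := MM_gamma' G (global_step G hf H)
  exact ⟨p, hp.proj, hp.orth, he, hs.isSup⟩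

lemma inf_seq {F : A} (hF : IsProjection F) (h : ¬ ProjFinite F) :
    ∃ g : ULift.{w} ℕ → A, Fam g ∧ (∀ i, g i ≠ 0) ∧ ∀ i, g i * F = g i := by
  unfold ProjFinite at h
  push Not at h
  obtain ⟨f, hf, ⟨v, h1, h2⟩, hfF, hne⟩ := h
  have hfF' : f * F = f := hfF
  have vF := pi_right G hF h1
  have fv := pi_left G hF h1 h2
  have Ff := le_comm hf hF hfF
  have Fv : F * v = v := by rw [← fv, ← mul_assoc, Ff]
  have vF' : star v * F = star v := by simpa [hF.1] using congrArg star Fv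
  set d := F - f with hd
  have dp : IsProjection d := sub_proj hf hF hfF
  have dF : d * F = d := by rw [hd, sub_mul, hF.2, hfF']
  have Fd : F * d = d := le_comm dp hF dF
  have dv : d * v = 0 := by rw [hd, sub_mul, Fv, fv]; simp
  have vd : star v * d = 0 := by simpa [dp.1] using congrArg star dv
  have d0 : d ≠ 0 := fun h => hne (sub_eq_zero.1 h).symm
  let w : ℕ → A := fun n => v ^ n * d
  have w1 : ∀ n, w (n + 1) = v * w n := fun n => by simp [w, pow_succ', mul_assoc]
  have wF : ∀ n, F * w n = w n := by
    intro n
    cases n with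
    | zero => simpa [w] using Fd
    | succ n => rw [w1, ← mul_assoc, Fv]
  have ww : ∀ n, star (w n) * w n = d := by
    intro n
    induction n with
    | zero => simp [w, dp.1, dp.2]
    | succ n ih => rw [w1, star_mul, mul_assoc, ← mul_assoc (star v), h1, wF, ih]
  have wo : ∀ m n, m < n → star (w m) * w n = 0 := by
    intro m
    induction m with
    | zero =>
      intro n hn
      obtain ⟨k, rfl⟩ := Nat.exists_eq_succ_of_ne_zero (by omega : n ≠ 0)
      rw [w1]; simp only [w, pow_zero, one_mul, dp.1]
      rw [← mul_assoc, dv, zero_mul]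
    | succ m ih =>
      intro n hn
      obtain ⟨k, rfl⟩ := Nat.exists_eq_succ_of_ne_zero (by omega : n ≠ 0)
      rw [w1, w1, star_mul, mul_assoc, ← mul_assoc (star v), h1, wF]
      exact ih k (by omega)
  have wo' : ∀ m n, m ≠ n → star (w m) * w n = 0 := by
    intro m n hmn
    rcases lt_or_gt_of_ne hmn with h | h
    · exact wo m n h
    · simpa using congrArg star (wo n m h)
  have gp : ∀ n, IsProjection (w n * star (w n)) := fun n => pi_proj G dp (ww n) rfl
  have ge : ∀ n, ProjEquiv d (w n * star (w n)) := fun n => ⟨w n, ww n, rfl⟩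
  refine ⟨fun n => w n.down * star (w n.down), ⟨fun n => gp _, fun m n hmn => ?_, fun m n =>
    eqv_trans (gp _) (gp _) (eqv_symm (ge _)) (ge _)⟩, fun n => eqv_ne G (ge _) d0, fun n => ?_⟩
  · rw [mul_assoc, ← mul_assoc (star _), wo' _ _ fun h => hmn (ULift.ext _ _ h)]; simp
  · exact le_of_left (gp _) hF (by rw [← mul_assoc, wF])

lemma main (e f c : A)
    (hf : ProperlyInfinite f)
    (hce : IsCentralCover e c) (hcf : IsCentralCover f c)
    (hef : ProjSubEquiv e f) (heP : IsProjection e) (I : Type w) (p : I → A) (hp : InGamma e p) :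
    ∃ (J : Type w) (q : J → A), InGamma f q ∧ Cardinal.mk I ≤ Cardinal.mk J := by
  by_cases hI : Infinite I
  · refine ⟨I, ?_⟩
    suffices h : ∃ q : I → A, InGamma f q by
      obtain ⟨q, hq⟩ := h; exact ⟨q, hq, le_rfl⟩
    apply global_gamma G hf.1
    intro z hz hzf
    obtain ⟨e', he', hle, v, h1, h2⟩ := hef
    have hle' : e' * f = e' := hle
    obtain ⟨hpP, hpo, hpe, hps⟩ := hp
    have hze : z * e ≠ 0 := by
      intro h0
      have hc := compl_central hz
      have h3 : ProjLE e (1 - z) := by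
        unfold ProjLE; rw [← hc.2, sub_mul, h0]; simp
      have h4 : c * (1 - z) = c := hce.2.2 _ hc h3
      have h5 : f * c = f := hcf.2.1
      apply hzf
      rw [hz.2, ← h5, ← h4, mul_assoc, mul_assoc, sub_mul, one_mul, hz.1.2]; simp
    have hc := fun i => cut G (hpP i) h1 (hps.2.1 i)
    have hzz := fun i => cmul_eqv hz (eqv_trans heP (hc i).1 (eqv_symm (hpe i)) (hc i).2.1)
    have hle2 : ∀ i, v * p i * star v * f = v * p i * star v := fun i => by
      have h6 := (hc i).2.2.2
      rw [h2] at h6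
      rw [← h6, mul_assoc, hle']
    refine ⟨fun i => z * (v * p i * star v), ⟨fun i => cmul_proj hz (hc i).1, fun i j hij => ?_,
      fun i j => eqv_trans (cmul_proj hz (hc i).1) (cmul_proj hz (hc j).1)
        (eqv_symm (hzz i)) (hzz j)⟩, fun i => eqv_ne G (hzz i) hze, fun i => cmul_le hz (hle2 i)⟩
    have : v * p i * star v * (v * p j * star v) = 0 := by
      calc _ = v * (p i * (star v * v) * p j) * star v := by simp only [mul_assoc]
        _ = 0 := by
          have h7 : p i * e = p i := hps.2.1 i
          rw [h1, h7, hpo i j hij]; simp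
    calc z * (v * p i * star v) * (z * (v * p j * star v))
        = z * ((v * p i * star v) * z) * (v * p j * star v) := by simp only [mul_assoc]
      _ = z * z * ((v * p i * star v) * (v * p j * star v)) := by
        rw [← hz.2]; simp only [mul_assoc]
      _ = 0 := by rw [this, mul_zero]
  · refine ⟨ULift.{w} ℕ, ?_⟩
    suffices h : ∃ q : ULift.{w} ℕ → A, InGamma f q by
      obtain ⟨q, hq⟩ := h
      have : Finite I := not_infinite_iff_finite.1 hI
      exact ⟨q, hq, (Cardinal.lt_aleph0_of_finite I).le.trans (Cardinal.aleph0_le_mk _)⟩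
    apply global_gamma G hf.1
    intro z hz hzf
    exact inf_seq G (cmul_proj hz hf.1) (hf.2.2 z hz hzf)

lemma bdd {f : A} (hf : f ≠ 0) : BddAbove {c : Cardinal.{w} |
    ∃ (ι : Type w) (p : ι → A), InGamma f p ∧ c = Order.succ (Cardinal.mk ι)} := by
  refine ⟨Order.succ (Cardinal.mk A), ?_⟩
  rintro _ ⟨ι, p, ⟨hp, ho, he, -⟩, rfl⟩
  apply Order.succ_le_succ
  refine Cardinal.mk_le_of_injective (f := p) fun i j hij => ?_
  by_contra h
  have := ho i j h
  rw [← hij, (hp i).2] at this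
  exact eqv_ne G (eqv_symm (he i)) hf this

lemma final (e f c : A)
    (he : ProperlyInfinite e) (hf : ProperlyInfinite f)
    (hce : IsCentralCover e c) (hcf : IsCentralCover f c)
    (hef : ProjSubEquiv e f) :
    projDim e ≤ projDim f := by
  unfold projDim
  rw [if_neg he.2.1, if_neg hf.2.1]
  apply csSup_le'
  rintro _ ⟨I, p, hp, rfl⟩
  obtain ⟨J, q, hq, hle⟩ := main G e f c hf hce hcf hef he.1 I p hp
  exact (Order.succ_le_succ hle).trans (le_csSup (bdd G hf.2.1) ⟨J, q, hq, rfl⟩)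

end

lemma good_all {A : Type*} [NormedRing A] [StarRing A] [CStarRing A]
    [NormedAlgebra ℂ A] [StarModule ℂ A] [CompleteSpace A]
    (hAW : IsAWStarRing A) : Good A := by
  refine ⟨hAW, ⟨algebraMap ℂ A (1 / 2), ?_, ?_, fun a => Algebra.commutes _ _⟩, fun x hx =>
    (CStarRing.star_mul_self_eq_zero_iff x).1 hx, ?_⟩
  · rw [← map_add]; norm_num
  · rw [← algebraMap_star_comm]; simp
  · let : CStarAlgebra A := {}
    exact good_of_cstar hAW

end AWProof

/-- If `e` and `f` are properly infinite projections with the same central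
cover and `e ≼ f`, then `d(e) ≤ d(f)`. -/
theorem projDim_le_of_subEquiv {A : Type u} [NormedRing A] [StarRing A] [CStarRing A]
    [NormedAlgebra ℂ A] [StarModule ℂ A] [CompleteSpace A]
    (hAW : IsAWStarRing A) (e f c : A)
    (he : ProperlyInfinite e) (hf : ProperlyInfinite f)
    (hce : IsCentralCover e c) (hcf : IsCentralCover f c)
    (hef : ProjSubEquiv e f) :
    projDim e ≤ projDim f := by
  exact AWProof.final (AWProof.good_all hAW) e f c he hf hce hcf hef
end
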